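/- arXiv:0712.2726 — 2 statements merged into one kernel-verified Lean document; each statement's English description precedes it below -/
import Mathlib

section
/- Let c : [0,∞) → [0,∞) be concave with c(0) = 0. For any two probability measures P and Q on ℝ with finite first moments, d_c(P,Q) ≤ c(d_1(P,Q)). -/
open MeasureTheory ProbabilityTheory Filter Set
open scoped ENNReal NNReal Topology

noncomputable section

/-- The intermittent (Liverani–Saussol–Vaienti) map `T_γ` on `[0,1]`. -/
def Tmap (γ : ℝ) (x : ℝ) : ℝ :=
  if x < 1/2 then x * (1 + 2 ^ γ * x ^ γ) else 2 * x - 1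

/-- `K` is the Perron–Frobenius operator of `T_γ` with respect to `ν`:
`ν(f · g∘T_γ) = ν(K f · g)` for all bounded measurable `f, g`. -/
def IsPFOp (γ : ℝ) (ν : Measure ℝ) (K : (ℝ → ℝ) → ℝ → ℝ) : Prop :=
  ∀ f g : ℝ → ℝ, Measurable f → Measurable g → (∃ C, ∀ x, |f x| ≤ C) →
    (∃ C, ∀ x, |g x| ≤ C) →
    ∫ x, f x * g (Tmap γ x) ∂ν = ∫ x, (K f) x * g x ∂ν

/-- Birkhoff sums `S_n(f) = ∑_{i=1}^n f ∘ T_γ^i`. -/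
def Sn (γ : ℝ) (f : ℝ → ℝ) (n : ℕ) (x : ℝ) : ℝ :=
  ∑ i ∈ Finset.range n, f ((Tmap γ)^[i + 1] x)

/-- The class `H_{α,1}` of `α`-Hölder functions (with constant 1) on `[0,1]`. -/
def Hclass (α : ℝ) : Set (ℝ → ℝ) :=
  {f | ∀ x ∈ Set.Icc (0:ℝ) 1, ∀ y ∈ Set.Icc (0:ℝ) 1, |f x - f y| ≤ |x - y| ^ α}

/-- `f_t = 1_{(-∞, t]}`. -/
def indic (t : ℝ) : ℝ → ℝ := Set.indicator (Set.Iic t) (fun _ => 1)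

/-- Nested operator `K^{(n_1,…,n_k)}(f_1,…,f_k)
= K^{n_1}(f_1 · K^{n_2}(f_2 ⋯ K^{n_k}(f_k)⋯))`, encoded by a list of pairs. -/
def nestedK (K : (ℝ → ℝ) → ℝ → ℝ) : List (ℕ × (ℝ → ℝ)) → ℝ → ℝ
  | [] => fun _ => 1
  | (n, f) :: r => K^[n] (fun x => f x * nestedK K r x)

/-- The list `[(n, f_{t_1}), (n_2, f_{t_2}), …, (n_l, f_{t_l})]`. -/
def tList (n : ℕ) {l : ℕ} (ns : Fin l → ℕ) (ts : Fin (l + 1) → ℝ) :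
    List (ℕ × (ℝ → ℝ)) :=
  (n, indic (ts 0)) :: List.ofFn (fun i : Fin l => (ns i, indic (ts i.succ)))

/-- The coefficient `α_1(n)` for an operator `K` with invariant measure `ν`. -/
def alpha1 (K : (ℝ → ℝ) → ℝ → ℝ) (ν : Measure ℝ) (n : ℕ) : ℝ :=
  ⨆ t : ℝ, ∫ x, |K^[n] (indic t) x - ∫ y, indic t y ∂ν| ∂ν

/-- The dependence coefficient `α_k(n)`. -/
def alphaCoef (K : (ℝ → ℝ) → ℝ → ℝ) (ν : Measure ℝ) (k n : ℕ) : ℝ :=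
  max (alpha1 K ν n)
    (⨆ j : Fin (k - 1), ⨆ ns : {m : Fin (j.1 + 1) → ℕ // ∀ i, 1 ≤ m i},
      ⨆ ts : Fin (j.1 + 2) → ℝ,
        ∫ x, |nestedK K (tList n ns.1 ts) x - ∫ y, nestedK K (tList n ns.1 ts) y ∂ν| ∂ν)

/-- The dependence coefficient `β_1(n)`. -/
def beta1 (K : (ℝ → ℝ) → ℝ → ℝ) (ν : Measure ℝ) (n : ℕ) : ℝ :=
  ∫ x, (⨆ t : ℝ, |K^[n] (indic t) x - ∫ y, indic t y ∂ν|) ∂ν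

/-- The dependence coefficient `β_k(n)`. -/
def betaCoef (K : (ℝ → ℝ) → ℝ → ℝ) (ν : Measure ℝ) (k n : ℕ) : ℝ :=
  max (beta1 K ν n)
    (⨆ j : Fin (k - 1), ⨆ ns : {m : Fin (j.1 + 1) → ℕ // ∀ i, 1 ≤ m i},
      ∫ x, (⨆ ts : Fin (j.1 + 2) → ℝ,
        |nestedK K (tList n ns.1 ts) x - ∫ y, nestedK K (tList n ns.1 ts) y ∂ν|) ∂ν)

/-- The operator associated with a Markov transition kernel: `(Kg)(x) = ∫ g(y) K(x,dy)`. -/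
def Kop (K : Kernel ℝ ℝ) (g : ℝ → ℝ) : ℝ → ℝ := fun x => ∫ y, g y ∂(K x)

/-- The class `Mon(M,p,μ)` of monotonic functions on an open interval, vanishing
elsewhere, with tail condition `μ(|g|>t) ≤ M^p t^{-p}` (for `p < ∞`),
resp. `μ(|g|>M) = 0` (for `p = ∞`). -/
def Mon (M : ℝ) (p : ℝ≥0∞) (μ : Measure ℝ) (g : ℝ → ℝ) : Prop :=
  (∃ I : Set ℝ, IsOpen I ∧ I.OrdConnected ∧ (MonotoneOn g I ∨ AntitoneOn g I) ∧
      ∀ x ∉ I, g x = 0) ∧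
  (if p = ∞ then μ {x | M < |g x|} = 0
   else ∀ t : ℝ, 0 < t →
      μ {x | t < |g x|} ≤ ENNReal.ofReal (M ^ p.toReal * t ^ (-p.toReal)))

/-- The class `C(M,p,μ)`: the closure in `L¹(μ)` of convex-type combinations
`∑ a_i g_i`, `∑ |a_i| ≤ 1`, `g_i ∈ Mon(M,p,μ)`. -/
def ClassC (M : ℝ) (p : ℝ≥0∞) (μ : Measure ℝ) (f : ℝ → ℝ) : Prop :=
  Integrable f μ ∧ ∀ ε : ℝ, 0 < ε → ∃ (n : ℕ) (a : Fin n → ℝ) (g : Fin n → ℝ → ℝ),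
    (∑ i, |a i|) ≤ 1 ∧ (∀ i, Mon M p μ (g i)) ∧
    ∫ x, |f x - ∑ i, a i * g i x| ∂μ < ε

/-- The class `Lip_c` of functions `g` with `|g(x) − g(y)| ≤ c(|x−y|)`. -/
def LipC (c : ℝ → ℝ) : Set (ℝ → ℝ) := {g | ∀ x y : ℝ, |g x - g y| ≤ c |x - y|}

/-- The distance `d_c(P,Q) = sup_{g ∈ Lip_c} |P(g) − Q(g)|`. -/
def dC (c : ℝ → ℝ) (P Q : Measure ℝ) : ℝ :=
  ⨆ g : LipC c, |(∫ x, (g : ℝ → ℝ) x ∂P) - ∫ x, (g : ℝ → ℝ) x ∂Q|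


/-- A convex function has a subgradient at every interior point of its domain. -/
lemma ConvexOn.exists_subgradient {S : Set ℝ} {f : ℝ → ℝ} (hf : ConvexOn ℝ S f) {x : ℝ}
    (hx : x ∈ interior S) : ∃ m : ℝ, ∀ y ∈ S, f x + m * (y - x) ≤ f y := by
  refine ⟨derivWithin f (Ioi x) x, fun y hy ↦ ?_⟩
  rcases lt_trichotomy y x with h | rfl | h
  · have hs := (hf.slope_le_leftDeriv_of_mem_interior hy hx h).trans
      (hf.leftDeriv_le_rightDeriv_of_mem_interior hx)
    rw [slope_def_field, div_le_iff₀ (by linarith)] at hs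
    linarith
  · simp
  · have hs := hf.rightDeriv_le_slope_of_mem_interior hx hy h
    rw [slope_def_field, le_div_iff₀ (by linarith)] at hs
    linarith

/-- A nonnegative concave function on `[0,∞)` has a nonnegative supergradient at every `s > 0`. -/
lemma ConcaveOn.exists_nonneg_supergradient {c : ℝ → ℝ} (hconc : ConcaveOn ℝ (Ici (0 : ℝ)) c)
    (hcnn : ∀ x : ℝ, 0 ≤ x → 0 ≤ c x) {s : ℝ} (hs : 0 < s) :
    ∃ m : ℝ, 0 ≤ m ∧ ∀ t, 0 ≤ t → c t ≤ c s + m * (t - s) := by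
  obtain ⟨m, hm⟩ := hconc.neg.exists_subgradient (x := s) (by simpa using hs)
  have hle : ∀ t, 0 ≤ t → c t ≤ c s + -m * (t - s) := fun t ht ↦ by
    have := hm t ht
    simp only [Pi.neg_apply] at this
    linarith
  refine ⟨-m, ?_, hle⟩
  by_contra! hneg
  have hcs := hcnn s hs.le
  have hm0 : 0 < m := by linarith
  have ht : 0 ≤ s + (c s + 1) / m := by positivity
  have h1 := hle _ ht
  have h2 := hcnn _ ht
  have h3 : -m * (s + (c s + 1) / m - s) = -(c s + 1) := by field_simp; ring
  linarith

lemma LipschitzWith.integrable_of_integrable_id {μ : Measure ℝ} [IsFiniteMeasure μ]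
    (hμ : Integrable (fun x : ℝ ↦ x) μ) {K : ℝ≥0} {f : ℝ → ℝ} (hf : LipschitzWith K f) :
    Integrable f μ := by
  refine ((integrable_const |f 0|).add (hμ.abs.const_mul (K : ℝ))).mono'
    hf.continuous.aestronglyMeasurable (ae_of_all _ fun x ↦ ?_)
  have h := hf.dist_le_mul x 0
  rw [Real.dist_eq, Real.dist_eq, sub_zero] at h
  have h' := abs_sub_abs_le_abs_sub (f x) (f 0)
  simp only [Real.norm_eq_abs, Pi.add_apply]
  linarith

lemma mem_LipC_id_iff {f : ℝ → ℝ} : f ∈ LipC (fun x ↦ x) ↔ LipschitzWith 1 f := by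
  simp [LipC, lipschitzWith_iff_dist_le_mul, Real.dist_eq]

lemma dC_nonneg (c : ℝ → ℝ) (P Q : Measure ℝ) : 0 ≤ dC c P Q :=
  Real.iSup_nonneg fun _ ↦ abs_nonneg _

section Kantorovich

variable {P Q : Measure ℝ} [IsProbabilityMeasure P] [IsProbabilityMeasure Q]

lemma bddAbove_dC_id (hP : Integrable (fun x : ℝ ↦ x) P) (hQ : Integrable (fun x : ℝ ↦ x) Q) :
    BddAbove (range fun g : LipC (fun x ↦ x) ↦
      |(∫ x, (g : ℝ → ℝ) x ∂P) - ∫ x, (g : ℝ → ℝ) x ∂Q|) := by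
  refine ⟨(∫ x, |x| ∂P) + ∫ x, |x| ∂Q, ?_⟩
  rintro _ ⟨⟨g, hg⟩, rfl⟩
  have key : ∀ (μ : Measure ℝ) [IsProbabilityMeasure μ], Integrable (fun x : ℝ ↦ x) μ →
      |(∫ x, g x ∂μ) - g 0| ≤ ∫ x, |x| ∂μ := by
    intro μ _ hμ
    have hgi := (mem_LipC_id_iff.1 hg).integrable_of_integrable_id hμ
    have h1 : (∫ x, g x ∂μ) - g 0 = ∫ x, (g x - g 0) ∂μ := by
      rw [integral_sub hgi (integrable_const _)]
      simp
    rw [h1]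
    refine abs_integral_le_integral_abs.trans
      (integral_mono (hgi.sub (integrable_const _)).abs hμ.abs fun x ↦ ?_)
    simpa using hg x 0
  have h1 := abs_le.1 (key P hP)
  have h2 := abs_le.1 (key Q hQ)
  exact abs_le.2 ⟨by linarith, by linarith⟩

lemma LipschitzWith.abs_integral_sub_le_dC_id (hP : Integrable (fun x : ℝ ↦ x) P)
    (hQ : Integrable (fun x : ℝ ↦ x) Q) {K : ℝ≥0} {f : ℝ → ℝ} (hf : LipschitzWith K f) :
    |(∫ x, f x ∂P) - ∫ x, f x ∂Q| ≤ K * dC (fun x ↦ x) P Q := by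
  rcases eq_or_ne K 0 with rfl | hK
  · obtain ⟨a, ha⟩ : ∃ a, ∀ x, f x = a := ⟨f 0, fun x ↦ by
      have h := hf.dist_le_mul x 0
      rw [NNReal.coe_zero, zero_mul] at h
      exact dist_le_zero.1 h⟩
    simp [ha]
  have hK' : (0 : ℝ) < K := by positivity
  have hg : (fun x ↦ (K : ℝ)⁻¹ * f x) ∈ LipC (fun x ↦ x) := fun x y ↦ by
    have h := hf.dist_le_mul x y
    rw [Real.dist_eq, Real.dist_eq] at h
    rw [← mul_sub, abs_mul, abs_of_pos (inv_pos.2 hK'), inv_mul_le_iff₀ hK']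
    exact h
  have h := le_ciSup (bddAbove_dC_id hP hQ) ⟨_, hg⟩
  simp only [integral_const_mul] at h
  rwa [← mul_sub, abs_mul, abs_of_pos (inv_pos.2 hK'), inv_mul_le_iff₀ hK'] at h

lemma eq_of_dC_id_eq_zero (hP : Integrable (fun x : ℝ ↦ x) P)
    (hQ : Integrable (fun x : ℝ ↦ x) Q) (h0 : dC (fun x ↦ x) P Q = 0) : P = Q := by
  refine ext_of_generate_finite _ ?_ isPiSystem_isClosed (fun F hF ↦ ?_) (by simp)
  · rw [BorelSpace.measurable_eq (α := ℝ), borel_eq_generateFrom_isClosed]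
  have hpos : ∀ n : ℕ, (0 : ℝ) < 1 / (n + 1) := fun n ↦ by positivity
  have hlim := tendsto_one_div_add_atTop_nhds_zero_nat (𝕜 := ℝ)
  have hTP := tendsto_integral_thickenedIndicator_of_isClosed P hF hpos hlim
  have hTQ := tendsto_integral_thickenedIndicator_of_isClosed Q hF hpos hlim
  have heq : ∀ n : ℕ, ∫ x, (thickenedIndicator (hpos n) F x : ℝ) ∂P
      = ∫ x, (thickenedIndicator (hpos n) F x : ℝ) ∂Q := fun n ↦ by
    have hl : LipschitzWith (1 / ((n : ℝ) + 1)).toNNReal⁻¹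
        (fun x ↦ (thickenedIndicator (hpos n) F x : ℝ)) :=
      fun x y ↦ lipschitzWith_thickenedIndicator (hpos n) F x y
    have h := hl.abs_integral_sub_le_dC_id hP hQ
    rw [h0, mul_zero] at h
    exact sub_eq_zero.1 (abs_nonpos_iff.1 h)
  simp_rw [heq] at hTP
  exact (measureReal_eq_measureReal_iff).1 (tendsto_nhds_unique hTP hTQ)

end Kantorovich

/-- If `g` satisfies `g x - g y ≤ a + m |x - y|`, then its `m`-Lipschitz lower envelope
is within `a` of `g`. -/
lemma exists_lipschitzWith_near {g : ℝ → ℝ} {a : ℝ} {m : ℝ≥0}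
    (hg : ∀ x y, g x - g y ≤ a + m * |x - y|) :
    ∃ h : ℝ → ℝ, LipschitzWith m h ∧ (∀ x, h x ≤ g x) ∧ ∀ x, g x ≤ h x + a := by
  have hbdd : ∀ x, BddBelow (range fun y ↦ g y + m * |x - y|) := fun x ↦ by
    refine ⟨g x - a, ?_⟩
    rintro _ ⟨y, rfl⟩
    have := hg x y
    linarith
  refine ⟨fun x ↦ ⨅ y, (g y + m * |x - y|), LipschitzWith.of_le_add_mul _ fun x z ↦ ?_,
    fun x ↦ ?_, fun x ↦ ?_⟩
  · rw [← sub_le_iff_le_add]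
    refine le_ciInf fun y ↦ ?_
    have h1 := ciInf_le (hbdd x) y
    have h2 : (m : ℝ) * |x - y| ≤ m * (|x - z| + |z - y|) :=
      mul_le_mul_of_nonneg_left (abs_sub_le x z y) m.2
    rw [Real.dist_eq]
    linarith
  · simpa using ciInf_le (hbdd x) x
  · rw [← sub_le_iff_le_add]
    refine le_ciInf fun y ↦ ?_
    have := hg x y
    linarith

/-- If some function of `Lip_c` is integrable for exactly one of the two measures, adding constants
to it shows that the set defining `d_c` is unbounded, so that the real supremum is `0`. -/
lemma dC_eq_zero_of_integrable_of_not_integrable {c : ℝ → ℝ} {P Q μ ν : Measure ℝ}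
    [IsProbabilityMeasure μ] [IsFiniteMeasure ν] {g : ℝ → ℝ} (hg : g ∈ LipC c)
    (hμ : Integrable g μ) (hν : ¬ Integrable g ν)
    (hPQ : ∀ f : ℝ → ℝ, |(∫ x, f x ∂P) - ∫ x, f x ∂Q| = |(∫ x, f x ∂μ) - ∫ x, f x ∂ν|) :
    dC c P Q = 0 := by
  refine Real.iSup_of_not_bddAbove ?_
  rintro ⟨B, hB⟩
  set K : ℝ := B + 1 - ∫ x, g x ∂μ
  have hgK : (fun x ↦ g x + K) ∈ LipC c := fun x y ↦ by simpa using hg x y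
  have h : |(∫ x, (g x + K) ∂P) - ∫ x, (g x + K) ∂Q| ≤ B := hB ⟨⟨_, hgK⟩, rfl⟩
  have hν' : ¬ Integrable (fun x ↦ g x + K) ν := by
    rwa [integrable_add_iff_integrable_left' (integrable_const K)]
  rw [hPQ, integral_undef hν', integral_add hμ (integrable_const _)] at h
  simp only [integral_const, probReal_univ, one_smul, sub_zero, K] at h
  have := le_abs_self ((∫ x, g x ∂μ) + (B + 1 - ∫ x, g x ∂μ))
  linarith

/-- for concave `c : [0,∞) → [0,∞)` with `c(0) = 0` and
probability measures `P, Q` on `ℝ` with finite first moments,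
`d_c(P,Q) ≤ c(d_1(P,Q))`, where `d_1` is the Kantorovich distance. -/
theorem statement11 (c : ℝ → ℝ) (hconc : ConcaveOn ℝ (Set.Ici (0:ℝ)) c)
    (hc0 : c 0 = 0) (hcnn : ∀ x : ℝ, 0 ≤ x → 0 ≤ c x)
    (P Q : Measure ℝ) [IsProbabilityMeasure P] [IsProbabilityMeasure Q]
    (hP : Integrable (fun x : ℝ => x) P) (hQ : Integrable (fun x : ℝ => x) Q) :
    dC c P Q ≤ c (dC (fun x => x) P Q) := by
  have hcd := hcnn _ (dC_nonneg (fun x ↦ x) P Q)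
  rcases (dC_nonneg (fun x ↦ x) P Q).eq_or_lt with h0 | hd
  · obtain rfl := eq_of_dC_id_eq_zero hP hQ h0.symm
    rw [← h0, hc0]
    simp [dC]
  by_cases hint : ∀ g ∈ LipC c, Integrable g P ↔ Integrable g Q
  swap
  · push Not at hint
    obtain ⟨g, hg, ⟨hgP, hgQ⟩ | ⟨hgP, hgQ⟩⟩ := hint
    · rwa [dC_eq_zero_of_integrable_of_not_integrable hg hgP hgQ fun _ ↦ rfl]
    · rwa [dC_eq_zero_of_integrable_of_not_integrable hg hgQ hgP fun _ ↦ abs_sub_comm _ _]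
  obtain ⟨m, hm, hmc⟩ := hconc.exists_nonneg_supergradient hcnn hd
  lift m to ℝ≥0 using hm
  refine Real.iSup_le (fun ⟨g, hg⟩ ↦ ?_) hcd
  by_cases hgP : Integrable g P
  swap
  · simpa [integral_undef hgP, integral_undef (mt (hint g hg).2 hgP)] using hcd
  have hgQ := (hint g hg).1 hgP
  obtain ⟨h, hlip, hle, hge⟩ := exists_lipschitzWith_near (g := g) (m := m)
    (a := c (dC (fun x ↦ x) P Q) - m * dC (fun x ↦ x) P Q) fun x y ↦ by
      have h1 := (le_abs_self _).trans (hg x y)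
      have h2 := hmc _ (abs_nonneg (x - y))
      linarith
  have hbound := abs_le.1 (hlip.abs_integral_sub_le_dC_id hP hQ)
  have hlow : ∀ (μ : Measure ℝ), Integrable g μ → Integrable h μ →
      ∫ x, h x ∂μ ≤ ∫ x, g x ∂μ := fun μ hg hh ↦ integral_mono hh hg hle
  have hupp : ∀ (μ : Measure ℝ) [IsProbabilityMeasure μ], Integrable g μ → Integrable h μ →
      ∫ x, g x ∂μ ≤ (∫ x, h x ∂μ) + (c (dC (fun x ↦ x) P Q) - m * dC (fun x ↦ x) P Q) := by
    intro μ _ hg hh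
    have := integral_mono hg (hh.add (integrable_const _)) hge
    simpa [integral_add hh (integrable_const _)] using this
  have hhP := hlip.integrable_of_integrable_id hP
  have hhQ := hlip.integrable_of_integrable_id hQ
  have h1 := hlow P hgP hhP
  have h2 := hlow Q hgQ hhQ
  have h3 := hupp P hgP hhP
  have h4 := hupp Q hgQ hhQ
  exact abs_le.2 ⟨by linarith, by linarith⟩

end
end

section
/- Let (X_i)_{i≥0} be a stationary Markov chain with invariant measure μ and transition kernel K, and let P_n(f) denote the law of n^{−1/2} Σ_{i=1}^n (f(X_i) − μ(f)). Assume f ∈ C(M,p,μ) for some M > 0 and p ∈ (2,∞], that Σ_{k>0} (α_1(k))^{(p−2)/p} < ∞, and that σ^2(μ,K,f) = 0. Then for every concave c : [0,∞) → [0,∞) with c(0) = 0, d_c(P_n(f), δ_0) = O(c(n^{−1/2})), where δ_0 is the Dirac mass at 0. -/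
open MeasureTheory ProbabilityTheory Filter Set
open scoped ENNReal NNReal Topology

noncomputable section

set_option linter.unusedSectionVars false

/-- An operator on functions which acts, modulo `μ`-null sets, like a Markov operator
preserving `μ`. -/
structure IsMarkovOp {α : Type*} [MeasurableSpace α] (μ : Measure α)
    (A : (α → ℝ) → α → ℝ) : Prop where
  integrable : ∀ {h : α → ℝ}, Integrable h μ → Integrable (A h) μ
  mono : ∀ {h h' : α → ℝ}, Integrable h μ → Integrable h' μ → h ≤ᵐ[μ] h' → A h ≤ᵐ[μ] A h'
  add : ∀ {h h' : α → ℝ}, Integrable h μ → Integrable h' μ → A (h + h') =ᵐ[μ] A h + A h'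
  smul : ∀ (c : ℝ) {h : α → ℝ}, Integrable h μ → A (c • h) =ᵐ[μ] c • A h
  const : ∀ c : ℝ, A (fun _ => c) =ᵐ[μ] fun _ => c
  integral : ∀ {h : α → ℝ}, Integrable h μ → ∫ x, A h x ∂μ = ∫ x, h x ∂μ
  memLp_two : ∀ {h : α → ℝ}, MemLp h 2 μ → MemLp (A h) 2 μ
  integral_sq_le : ∀ {h : α → ℝ}, MemLp h 2 μ → ∫ x, (A h x) ^ 2 ∂μ ≤ ∫ x, (h x) ^ 2 ∂μ

namespace IsMarkovOp

variable {α : Type*} [MeasurableSpace α] {μ : Measure α} [IsProbabilityMeasure μ]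
  {A B : (α → ℝ) → α → ℝ} {h h' : α → ℝ}

lemma congr (hA : IsMarkovOp μ A) (hh : Integrable h μ) (e : h =ᵐ[μ] h') : A h =ᵐ[μ] A h' := by
  have hh' := hh.congr e
  filter_upwards [hA.mono hh hh' e.le, hA.mono hh' hh e.symm.le] with x h1 h2
  exact le_antisymm h1 h2

lemma comp (hA : IsMarkovOp μ A) (hB : IsMarkovOp μ B) : IsMarkovOp μ (A ∘ B) where
  integrable hh := hA.integrable (hB.integrable hh)
  mono hh hh' e := hA.mono (hB.integrable hh) (hB.integrable hh') (hB.mono hh hh' e)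
  add hh hh' := (hA.congr (hB.integrable (hh.add hh')) (hB.add hh hh')).trans
    (hA.add (hB.integrable hh) (hB.integrable hh'))
  smul c _ hh := (hA.congr (hB.integrable (hh.smul c)) (hB.smul c hh)).trans
    (hA.smul c (hB.integrable hh))
  const c := (hA.congr (hB.integrable (integrable_const c)) (hB.const c)).trans (hA.const c)
  integral hh := (hA.integral (hB.integrable hh)).trans (hB.integral hh)
  memLp_two hh := hA.memLp_two (hB.memLp_two hh)
  integral_sq_le hh := (hA.integral_sq_le (hB.memLp_two hh)).trans (hB.integral_sq_le hh)

lemma iterate (hA : IsMarkovOp μ A) (n : ℕ) : IsMarkovOp μ A^[n] := by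
  induction n with
  | zero =>
    simp only [Function.iterate_zero]
    exact ⟨fun h => h, fun _ _ h => h, fun _ _ => .rfl, fun _ _ _ => .rfl, fun _ => .rfl,
      fun _ => rfl, fun h => h, fun _ => le_rfl⟩
  | succ n ih => exact ih.comp hA

lemma sub (hA : IsMarkovOp μ A) (hh : Integrable h μ) (hh' : Integrable h' μ) :
    A (h - h') =ᵐ[μ] A h - A h' := by
  have e : h - h' = h + (-1 : ℝ) • h' := by ext x; simp [sub_eq_add_neg]
  rw [e]
  filter_upwards [hA.add hh (hh'.smul (-1 : ℝ)), hA.smul (-1) hh'] with x h1 h2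
  rw [h1, Pi.add_apply, h2]
  simp [sub_eq_add_neg]

lemma sum (hA : IsMarkovOp μ A) {ι : Type*} (s : Finset ι) {g : ι → α → ℝ}
    (hg : ∀ i ∈ s, Integrable (g i) μ) :
    A (∑ i ∈ s, g i) =ᵐ[μ] ∑ i ∈ s, A (g i) := by
  classical
  induction s using Finset.induction_on with
  | empty => exact hA.const 0
  | insert i s hi ih =>
    rw [Finset.sum_insert hi, Finset.sum_insert hi]
    have hs : ∀ j ∈ s, Integrable (g j) μ := fun j hj => hg j (Finset.mem_insert_of_mem hj)
    refine (hA.add (hg i (Finset.mem_insert_self i s)) (integrable_finsetSum' s hs)).trans ?_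
    filter_upwards [ih hs] with x hx
    simp only [Pi.add_apply, hx]

lemma abs_le (hA : IsMarkovOp μ A) (hh : Integrable h μ) :
    ∀ᵐ x ∂μ, |A h x| ≤ A (fun x => |h x|) x := by
  have e : (-1 : ℝ) • h ≤ᵐ[μ] fun x => |h x| :=
    Eventually.of_forall fun x => by simpa using neg_le_abs (h x)
  filter_upwards [hA.mono hh hh.abs (Eventually.of_forall fun x => le_abs_self (h x)),
    hA.mono (hh.smul (-1 : ℝ)) hh.abs e, hA.smul (-1) hh] with x h1 h2 h3
  rw [h3] at h2
  exact abs_le'.2 ⟨h1, by simpa using h2⟩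

lemma integral_abs_le (hA : IsMarkovOp μ A) (hh : Integrable h μ) :
    ∫ x, |A h x| ∂μ ≤ ∫ x, |h x| ∂μ := by
  rw [← hA.integral hh.abs]
  exact integral_mono_ae (hA.integrable hh).abs (hA.integrable hh.abs) (hA.abs_le hh)

lemma abs_le_const (hA : IsMarkovOp μ A) (hh : Integrable h μ) {T : ℝ}
    (hT : ∀ᵐ x ∂μ, |h x| ≤ T) : ∀ᵐ x ∂μ, |A h x| ≤ T := by
  filter_upwards [hA.abs_le hh, hA.mono hh.abs (integrable_const T) hT, hA.const T]
    with x h1 h2 h3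
  exact h1.trans (h2.trans h3.le)

end IsMarkovOp

/-- The mean absolute deviation of `A h` from the mean of `h`. -/
def meanDev {α : Type*} [MeasurableSpace α] (μ : Measure α) (A : (α → ℝ) → α → ℝ)
    (h : α → ℝ) : ℝ := ∫ x, |A h x - ∫ y, h y ∂μ| ∂μ

section MeanDev

variable {α : Type*} [MeasurableSpace α] {μ : Measure α} [IsProbabilityMeasure μ]
  {A : (α → ℝ) → α → ℝ} {h h' : α → ℝ}

lemma meanDev_nonneg : 0 ≤ meanDev μ A h := integral_nonneg fun _ => abs_nonneg _

lemma IsMarkovOp.integrable_dev (hA : IsMarkovOp μ A) (hh : Integrable h μ) :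
    Integrable (fun x => A h x - ∫ y, h y ∂μ) μ :=
  (hA.integrable hh).sub (integrable_const _)

lemma meanDev_add_le (hA : IsMarkovOp μ A) (hh : Integrable h μ) (hh' : Integrable h' μ) :
    meanDev μ A (h + h') ≤ meanDev μ A h + meanDev μ A h' := by
  unfold meanDev
  rw [← integral_add (hA.integrable_dev hh).abs (hA.integrable_dev hh').abs]
  refine integral_mono_ae (hA.integrable_dev (hh.add hh')).abs
    ((hA.integrable_dev hh).abs.add (hA.integrable_dev hh').abs) ?_
  filter_upwards [hA.add hh hh'] with x hx
  have e : ∫ y, (h + h') y ∂μ = ∫ y, h y ∂μ + ∫ y, h' y ∂μ := integral_add hh hh'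
  rw [hx, e, Pi.add_apply, add_sub_add_comm]
  exact abs_add_le _ _

lemma meanDev_smul (hA : IsMarkovOp μ A) (c : ℝ) (hh : Integrable h μ) :
    meanDev μ A (c • h) = |c| * meanDev μ A h := by
  unfold meanDev
  rw [← integral_const_mul]
  refine integral_congr_ae ?_
  filter_upwards [hA.smul c hh] with x hx
  have e : ∫ y, (c • h) y ∂μ = c * ∫ y, h y ∂μ := integral_const_mul c h
  rw [hx, e, Pi.smul_apply, smul_eq_mul, ← mul_sub, abs_mul]

lemma meanDev_le (hA : IsMarkovOp μ A) (hh : Integrable h μ) :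
    meanDev μ A h ≤ 2 * ∫ x, |h x| ∂μ := by
  calc meanDev μ A h ≤ ∫ x, (|A h x| + |∫ y, h y ∂μ|) ∂μ :=
        integral_mono (hA.integrable_dev hh).abs
          ((hA.integrable hh).abs.add (integrable_const _)) fun x => abs_sub _ _
    _ = ∫ x, |A h x| ∂μ + |∫ y, h y ∂μ| := by
        rw [integral_add (hA.integrable hh).abs (integrable_const _)]; simp
    _ ≤ _ := by
        have := hA.integral_abs_le hh
        have := abs_integral_le_integral_abs (f := h) (μ := μ)
        linarith

lemma meanDev_le_add (hA : IsMarkovOp μ A) (hh : Integrable h μ) (hh' : Integrable h' μ) :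
    meanDev μ A h ≤ meanDev μ A h' + 2 * ∫ x, |h x - h' x| ∂μ := by
  have e : h = h' + (h - h') := by ext x; simp
  calc meanDev μ A h = meanDev μ A (h' + (h - h')) := by rw [← e]
    _ ≤ meanDev μ A h' + meanDev μ A (h - h') := meanDev_add_le hA hh' (hh.sub hh')
    _ ≤ _ := by gcongr; exact meanDev_le hA (hh.sub hh')

lemma meanDev_sub_le (hA : IsMarkovOp μ A) (hh : Integrable h μ) (hh' : Integrable h' μ) :
    meanDev μ A (h - h') ≤ meanDev μ A h + meanDev μ A h' := by
  have e : h - h' = h + (-1 : ℝ) • h' := by ext x; simp [sub_eq_add_neg]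
  rw [e]
  refine (meanDev_add_le hA hh (hh'.smul (-1 : ℝ))).trans ?_
  rw [meanDev_smul hA (-1) hh']
  simp

lemma meanDev_const (hA : IsMarkovOp μ A) (c : ℝ) : meanDev μ A (fun _ => c) = 0 := by
  unfold meanDev
  rw [← integral_zero α ℝ (μ := μ)]
  refine integral_congr_ae ?_
  filter_upwards [hA.const c] with x hx
  simp [hx]

lemma meanDev_sum_le (hA : IsMarkovOp μ A) {ι : Type*} (s : Finset ι) {g : ι → α → ℝ}
    (hg : ∀ i ∈ s, Integrable (g i) μ) :
    meanDev μ A (∑ i ∈ s, g i) ≤ ∑ i ∈ s, meanDev μ A (g i) := by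
  classical
  induction s using Finset.induction_on with
  | empty => exact (meanDev_const hA 0).le
  | insert i s hi ih =>
    rw [Finset.sum_insert hi, Finset.sum_insert hi]
    have hs : ∀ j ∈ s, Integrable (g j) μ := fun j hj => hg j (Finset.mem_insert_of_mem hj)
    refine (meanDev_add_le hA (hg i (Finset.mem_insert_self i s))
      (integrable_finsetSum' s hs)).trans ?_
    gcongr
    exact ih hs

end MeanDev

section KopMarkov

variable {μ : Measure ℝ} [IsProbabilityMeasure μ] {K : Kernel ℝ ℝ} [IsMarkovKernel K]
  {h : ℝ → ℝ}

lemma sq_integral_le_integral_sq {α : Type*} [MeasurableSpace α] {ν : Measure α}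
    [IsProbabilityMeasure ν] {g : α → ℝ} (hg : MemLp g 2 ν) :
    (∫ y, g y ∂ν) ^ 2 ≤ ∫ y, (g y) ^ 2 ∂ν := by
  have h1 := variance_eq_sub hg
  have h2 := variance_nonneg g ν
  simp only [Pi.pow_apply] at h1
  linarith

lemma snd_compProd_of_bind_eq (hinv : μ.bind (fun x => K x) = μ) : (μ ⊗ₘ K).snd = μ :=
  (Measure.snd_compProd μ K).trans hinv

lemma measurePreserving_fst_compProd : MeasurePreserving Prod.fst (μ ⊗ₘ K) μ :=
  ⟨measurable_fst, Measure.fst_compProd μ K⟩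

lemma measurePreserving_snd_compProd (hinv : μ.bind (fun x => K x) = μ) :
    MeasurePreserving Prod.snd (μ ⊗ₘ K) μ :=
  ⟨measurable_snd, snd_compProd_of_bind_eq hinv⟩

lemma ae_ae_kernel_of_ae (hinv : μ.bind (fun x => K x) = μ) {q : ℝ → Prop}
    (hq : ∀ᵐ x ∂μ, q x) : ∀ᵐ x ∂μ, ∀ᵐ y ∂(K x), q y :=
  Measure.ae_ae_of_ae_comp (by rw [← hinv] at hq; exact hq)

lemma integrable_comp_snd (hinv : μ.bind (fun x => K x) = μ) (hh : Integrable h μ) :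
    Integrable (fun z : ℝ × ℝ => h z.2) (μ ⊗ₘ K) :=
  (measurePreserving_snd_compProd hinv).integrable_comp_of_integrable hh

lemma ae_integrable_kernel (hinv : μ.bind (fun x => K x) = μ) (hh : Integrable h μ) :
    ∀ᵐ x ∂μ, Integrable h (K x) :=
  Measure.ae_integrable_of_integrable_comp (by rw [← hinv] at hh; exact hh)

lemma integrable_Kop (hinv : μ.bind (fun x => K x) = μ) (hh : Integrable h μ) :
    Integrable (Kop K h) μ := by
  have h1 : Integrable h (K ∘ₘ μ) := by rw [← hinv] at hh; exact hh
  rw [Measure.comp_eq_comp_const_apply] at h1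
  exact h1.integral_comp

lemma integral_Kop (hinv : μ.bind (fun x => K x) = μ) (hh : Integrable h μ) :
    ∫ x, Kop K h x ∂μ = ∫ x, h x ∂μ := by
  have h1 := Measure.integral_compProd (integrable_comp_snd hinv hh)
  have h2 : ∫ x, h x ∂((μ ⊗ₘ K).map Prod.snd) = ∫ z, h z.2 ∂(μ ⊗ₘ K) :=
    integral_map measurable_snd.aemeasurable
      (by rw [(measurePreserving_snd_compProd hinv).map_eq]; exact hh.aestronglyMeasurable)
  rw [(measurePreserving_snd_compProd hinv).map_eq] at h2
  exact (h2.trans h1).symm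

lemma ae_sq_Kop_le (hinv : μ.bind (fun x => K x) = μ) (hh : MemLp h 2 μ) :
    ∀ᵐ x ∂μ, (Kop K h x) ^ 2 ≤ Kop K (fun y => (h y) ^ 2) x := by
  filter_upwards [ae_integrable_kernel hinv hh.integrable_sq,
    ae_integrable_kernel hinv (hh.integrable one_le_two)] with x h1 h2
  exact sq_integral_le_integral_sq ((memLp_two_iff_integrable_sq h2.1).2 h1)

lemma memLp_two_Kop (hinv : μ.bind (fun x => K x) = μ) (hh : MemLp h 2 μ) :
    MemLp (Kop K h) 2 μ := by
  have hm := (integrable_Kop hinv (hh.integrable one_le_two)).1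
  rw [memLp_two_iff_integrable_sq hm]
  refine (integrable_Kop hinv hh.integrable_sq).mono' (hm.pow 2) ?_
  filter_upwards [ae_sq_Kop_le hinv hh] with x hx
  rwa [Real.norm_of_nonneg (sq_nonneg _)]

lemma isMarkovOp_Kop (hinv : μ.bind (fun x => K x) = μ) : IsMarkovOp μ (Kop K) where
  integrable := integrable_Kop hinv
  mono hh hh' e := by
    filter_upwards [ae_integrable_kernel hinv hh, ae_integrable_kernel hinv hh',
      ae_ae_kernel_of_ae hinv e] with x h1 h2 h3
    exact integral_mono_ae h1 h2 h3
  add hh hh' := by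
    filter_upwards [ae_integrable_kernel hinv hh, ae_integrable_kernel hinv hh'] with x h1 h2
    exact integral_add h1 h2
  smul c h _ := Eventually.of_forall fun x => integral_const_mul c h
  const c := Eventually.of_forall fun x => by simp [Kop]
  integral := integral_Kop hinv
  memLp_two := memLp_two_Kop hinv
  integral_sq_le hh := by
    rw [← integral_Kop hinv hh.integrable_sq]
    exact integral_mono_ae (memLp_two_Kop hinv hh).integrable_sq
      (integrable_Kop hinv hh.integrable_sq) (ae_sq_Kop_le hinv hh)

/-- The conditional variance formula for one step of the stationary chain. -/
lemma integral_sq_sub_Kop (hinv : μ.bind (fun x => K x) = μ) (hh : MemLp h 2 μ) :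
    MemLp (fun z : ℝ × ℝ => h z.2 - Kop K h z.1) 2 (μ ⊗ₘ K) ∧
    ∫ z, (h z.2 - Kop K h z.1) ^ 2 ∂(μ ⊗ₘ K)
      = ∫ x, (h x) ^ 2 ∂μ - ∫ x, (Kop K h x) ^ 2 ∂μ := by
  have hs := hh.comp_measurePreserving (measurePreserving_snd_compProd (K := K) hinv)
  have hk := memLp_two_Kop hinv hh
  have hf := hk.comp_measurePreserving (measurePreserving_fst_compProd (μ := μ) (K := K))
  refine ⟨hs.sub hf, ?_⟩
  have hsf : Integrable (fun z : ℝ × ℝ => Kop K h z.1 * h z.2) (μ ⊗ₘ K) := hf.integrable_mul hs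
  have e : ∀ z : ℝ × ℝ, (h z.2 - Kop K h z.1) ^ 2
      = (h z.2) ^ 2 - 2 * (Kop K h z.1 * h z.2) + (Kop K h z.1) ^ 2 := fun z => by ring
  simp_rw [e]
  have i1 : Integrable (fun z : ℝ × ℝ => (h z.2) ^ 2) (μ ⊗ₘ K) := hs.integrable_sq
  have i2 : Integrable (fun z : ℝ × ℝ => (Kop K h z.1) ^ 2) (μ ⊗ₘ K) := hf.integrable_sq
  have i3 : Integrable (fun z : ℝ × ℝ => (h z.2) ^ 2 - 2 * (Kop K h z.1 * h z.2)) (μ ⊗ₘ K) :=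
    i1.sub (hsf.const_mul 2)
  rw [integral_add i3 i2, integral_sub i1 (hsf.const_mul 2),
    integral_const_mul, Measure.integral_compProd hsf, Measure.integral_compProd i1,
    Measure.integral_compProd i2]
  have e1 : ∫ x, ∫ y, (h y) ^ 2 ∂(K x) ∂μ = ∫ x, (h x) ^ 2 ∂μ := integral_Kop hinv hh.integrable_sq
  have e2 : ∫ x, ∫ y, Kop K h x * h y ∂(K x) ∂μ = ∫ x, (Kop K h x) ^ 2 ∂μ := by
    congr 1; ext x; rw [integral_const_mul, sq]; rfl
  simp only [e1, e2, integral_const, probReal_univ, one_smul]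
  ring

end KopMarkov

section Intervals

variable {μ : Measure ℝ} [IsProbabilityMeasure μ] {A : (ℝ → ℝ) → ℝ → ℝ} {a : ℝ}

lemma integrable_indicator_one {s : Set ℝ} (hs : MeasurableSet s) :
    Integrable (s.indicator fun _ => (1 : ℝ)) μ :=
  (integrable_const (1 : ℝ)).indicator hs

lemma integrable_indic (t : ℝ) : Integrable (indic t) μ :=
  integrable_indicator_one measurableSet_Iic

lemma meanDev_indicator_Iio_le (hA : IsMarkovOp μ A) (ha : ∀ t, meanDev μ A (indic t) ≤ a)
    (t : ℝ) : meanDev μ A ((Iio t).indicator fun _ => 1) ≤ a := by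
  have key : ∀ n : ℕ, meanDev μ A ((Iio t).indicator fun _ => 1)
      ≤ a + 2 * μ.real (Ioo (t - 1 / ((n : ℝ) + 1)) t) := fun n => by
    refine (meanDev_le_add hA (integrable_indicator_one measurableSet_Iio)
      (integrable_indic (t - 1 / ((n : ℝ) + 1)))).trans (add_le_add (ha _) ?_)
    have hpos : (0 : ℝ) < 1 / ((n : ℝ) + 1) := by positivity
    have e : ∀ x, |(Iio t).indicator (fun _ => (1 : ℝ)) x - indic (t - 1 / ((n : ℝ) + 1)) x|
        = (Ioo (t - 1 / ((n : ℝ) + 1)) t).indicator (fun _ => (1 : ℝ)) x := fun x => by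
      by_cases h1 : x < t <;> by_cases h2 : x ≤ t - 1 / ((n : ℝ) + 1)
      · simp [indic, indicator, h1, h2, not_lt.2 h2, -one_div]
      · simp [indic, indicator, h1, h2, not_le.1 h2, -one_div]
      · exact absurd (by linarith) h1
      · simp [indic, indicator, h1, h2, -one_div]
    simp_rw [e]
    rw [integral_indicator measurableSet_Ioo]
    simp
  have hlim : Tendsto (fun n : ℕ => μ.real (Ioo (t - 1 / ((n : ℝ) + 1)) t)) atTop (𝓝 0) := by
    have hanti : Antitone fun n : ℕ => Ioo (t - 1 / ((n : ℝ) + 1)) t := fun m n hmn =>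
      Ioo_subset_Ioo_left (by
        have := Nat.one_div_le_one_div (α := ℝ) hmn
        linarith)
    have hempty : ⋂ n : ℕ, Ioo (t - 1 / ((n : ℝ) + 1)) t = ∅ := by
      refine eq_empty_of_forall_notMem fun x hx => ?_
      rw [mem_iInter] at hx
      obtain ⟨n, hn⟩ := exists_nat_one_div_lt (sub_pos.2 (hx 0).2)
      have := (hx n).1
      linarith
    have h := tendsto_measure_iInter_atTop (μ := μ)
      (fun n : ℕ => (measurableSet_Ioo (a := t - 1 / ((n : ℝ) + 1)) (b := t)).nullMeasurableSet)
      hanti ⟨0, measure_ne_top _ _⟩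
    rw [hempty, measure_empty] at h
    exact (ENNReal.tendsto_toReal ENNReal.zero_ne_top).comp h
  have h2 := (hlim.const_mul 2).const_add a
  rw [mul_zero, add_zero] at h2
  exact ge_of_tendsto' h2 key

lemma meanDev_indicator_lowerSet_le (hA : IsMarkovOp μ A)
    (ha : ∀ t, meanDev μ A (indic t) ≤ a) {L : Set ℝ} (hL : IsLowerSet L) :
    meanDev μ A (L.indicator fun _ => 1) ≤ a := by
  have ha0 : 0 ≤ a := meanDev_nonneg.trans (ha 0)
  rcases L.eq_empty_or_nonempty with rfl | hne
  · simpa using (meanDev_const hA 0).le.trans ha0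
  by_cases hb : BddAbove L
  · by_cases hm : sSup L ∈ L
    · have : L = Iic (sSup L) := Subset.antisymm (fun x hx => le_csSup hb hx)
        fun x hx => hL hx hm
      rw [this]
      exact ha _
    · have : L = Iio (sSup L) := Subset.antisymm
        (fun x hx => lt_of_le_of_ne (le_csSup hb hx) fun e => hm (e ▸ hx))
        fun x hx => by
          obtain ⟨y, hy, hxy⟩ := exists_lt_of_lt_csSup hne hx
          exact hL hxy.le hy
      rw [this]
      exact meanDev_indicator_Iio_le hA ha _
  · have : L = univ := eq_univ_of_forall fun x => by
      obtain ⟨y, hy, hxy⟩ := not_bddAbove_iff.1 hb x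
      exact hL hxy.le hy
    rw [this, indicator_univ]
    exact (meanDev_const hA 1).le.trans ha0

lemma meanDev_indicator_ordConnected_le (hA : IsMarkovOp μ A)
    (ha : ∀ t, meanDev μ A (indic t) ≤ a) {J : Set ℝ} (hJ : J.OrdConnected) :
    meanDev μ A (J.indicator fun _ => 1) ≤ 2 * a := by
  set L : Set ℝ := ((lowerClosure J : LowerSet ℝ) : Set ℝ)
  have hL : IsLowerSet L := (lowerClosure J).lower
  have hJL : J ⊆ L := subset_lowerClosure
  have hL' : IsLowerSet (L \ J) := fun x y hyx hx =>
    ⟨hL hyx hx.1, fun hy => by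
      obtain ⟨j, hj, hxj⟩ := mem_lowerClosure.1 hx.1
      exact hx.2 (hJ.out hy hj ⟨hyx, hxj⟩)⟩
  have e : (J.indicator fun _ => (1 : ℝ))
      = (L.indicator fun _ => 1) - (L \ J).indicator fun _ => 1 := by
    ext x
    by_cases h1 : x ∈ J
    · simp [h1, hJL h1]
    · by_cases h2 : x ∈ L <;> simp [h1, h2]
  rw [e]
  refine (meanDev_sub_le hA (integrable_indicator_one hL.ordConnected.measurableSet)
    (integrable_indicator_one hL'.ordConnected.measurableSet)).trans ?_
  linarith [meanDev_indicator_lowerSet_le hA ha hL, meanDev_indicator_lowerSet_le hA ha hL']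

lemma sum_indicator_le_eq_floor {y : ℝ} {m : ℕ} (hy : 0 ≤ y) (hym : y ≤ m) :
    ∑ j ∈ Finset.range m, (if ((j : ℝ) + 1) ≤ y then (1 : ℝ) else 0) = ⌊y⌋₊ := by
  rw [← Finset.sum_filter]
  have : Finset.filter (fun j : ℕ => ((j : ℝ) + 1) ≤ y) (Finset.range m)
      = Finset.range ⌊y⌋₊ := by
    ext j
    simp only [Finset.mem_filter, Finset.mem_range]
    have h1 : ((j : ℝ) + 1) ≤ y ↔ j < ⌊y⌋₊ := by
      rw [← Nat.succ_le_iff, Nat.le_floor_iff hy]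
      push_cast
      rfl
    rw [h1]
    refine ⟨fun h => h.2, fun h => ⟨h.trans_le ?_, h⟩⟩
    exact_mod_cast (Nat.floor_le hy).trans hym
  rw [this]
  simp

lemma meanDev_le_of_ordConnected_superlevel (hA : IsMarkovOp μ A)
    (ha : ∀ t, meanDev μ A (indic t) ≤ a) {T : ℝ} (hT : 0 < T) {w : ℝ → ℝ}
    (hw : Integrable w μ) (hw0 : ∀ x, 0 ≤ w x) (hwT : ∀ x, w x ≤ T)
    (hconn : ∀ t, 0 < t → {x | t ≤ w x}.OrdConnected) :
    meanDev μ A w ≤ 2 * T * a := by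
  have ha0 : 0 ≤ a := meanDev_nonneg.trans (ha 0)
  have key : ∀ n : ℕ, meanDev μ A w ≤ 2 * T * a + 2 * T * (1 / ((n : ℝ) + 1)) := fun n => by
    set m : ℕ := n + 1 with hm
    have hm0 : (0 : ℝ) < m := by rw [hm]; positivity
    have hmc : (m : ℝ) = (n : ℝ) + 1 := by rw [hm]; push_cast; rfl
    set J : ℕ → Set ℝ := fun j => {x | T / m * ((j : ℝ) + 1) ≤ w x} with hJ
    have hJc : ∀ j, (J j).OrdConnected := fun j => hconn _ (by positivity)
    set g : ℕ → ℝ → ℝ := fun j => (J j).indicator fun _ => (1 : ℝ) with hg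
    have hgi : ∀ j ∈ Finset.range m, Integrable (g j) μ := fun j _ =>
      integrable_indicator_one (hJc j).measurableSet
    have hsum : Integrable (∑ j ∈ Finset.range m, g j) μ := integrable_finsetSum' _ hgi
    have hd : meanDev μ A ((T / m) • ∑ j ∈ Finset.range m, g j) ≤ 2 * T * a := by
      rw [meanDev_smul hA _ hsum, abs_of_pos (by positivity)]
      calc T / m * meanDev μ A (∑ j ∈ Finset.range m, g j)
          ≤ T / m * ∑ j ∈ Finset.range m, meanDev μ A (g j) := by
            gcongr; exact meanDev_sum_le hA _ hgi
        _ ≤ T / m * ∑ j ∈ Finset.range m, 2 * a := by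
            gcongr with j _; exact meanDev_indicator_ordConnected_le hA ha (hJc j)
        _ = 2 * T * a := by
            rw [Finset.sum_const, Finset.card_range, nsmul_eq_mul]; field_simp
    have hclose : ∀ x, |w x - ((T / m) • ∑ j ∈ Finset.range m, g j) x| ≤ T / m := fun x => by
      have hy0 : 0 ≤ w x * m / T := by have := hw0 x; positivity
      have hym : w x * m / T ≤ m := by
        rw [div_le_iff₀ hT, mul_comm]; gcongr; exact hwT x
      have e : (∑ j ∈ Finset.range m, g j) x = ⌊w x * m / T⌋₊ := by
        rw [← sum_indicator_le_eq_floor hy0 hym, Finset.sum_apply]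
        refine Finset.sum_congr rfl fun j _ => ?_
        have : x ∈ J j ↔ ((j : ℝ) + 1) ≤ w x * m / T := by
          rw [hJ, mem_ofPred_eq, le_div_iff₀ hT, div_mul_eq_mul_div, div_le_iff₀ hm0, mul_comm T]
        simp only [hg, indicator, this]
      rw [Pi.smul_apply, e, smul_eq_mul]
      have h1 := Nat.floor_le hy0
      have h2 := Nat.lt_floor_add_one (w x * m / T)
      have h3 : w x = T / m * (w x * m / T) := by field_simp
      have h4 : w x - T / m * ⌊w x * m / T⌋₊ = T / m * (w x * m / T - ⌊w x * m / T⌋₊) := by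
        rw [mul_sub, ← h3]
      rw [h4, abs_of_nonneg (by have := sub_nonneg.2 h1; positivity)]
      have : T / m * (w x * m / T - ⌊w x * m / T⌋₊) ≤ T / m * 1 := by
        gcongr; linarith
      linarith
    refine (meanDev_le_add hA hw (hsum.smul (T / m))).trans (add_le_add hd ?_)
    have h5 : ∫ x, |w x - ((T / m) • ∑ j ∈ Finset.range m, g j) x| ∂μ ≤ ∫ _, T / m ∂μ :=
      integral_mono (hw.sub (hsum.smul (T / m))).abs (integrable_const _) hclose
    simp only [integral_const, probReal_univ, one_smul] at h5
    rw [mul_assoc, ← hmc, mul_one_div]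
    linarith
  have h2 := ((tendsto_one_div_add_atTop_nhds_zero_nat (𝕜 := ℝ)).const_mul (2 * T)).const_add
    (2 * T * a)
  rw [mul_zero, add_zero] at h2
  exact ge_of_tendsto' h2 key

end Intervals

/-- The part of `|x|` exceeding the level `T`. -/
def excess (T x : ℝ) : ℝ := max (|x| - T) 0

/-- Truncation of `x` to the interval `[-T, T]`. -/
def clip (T x : ℝ) : ℝ := max (-T) (min x T)

section ExcessClip

variable {S T x : ℝ}

lemma excess_nonneg : 0 ≤ excess T x := le_max_right _ _

lemma abs_le_add_excess : |x| ≤ T + excess T x := by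
  have := le_max_left (|x| - T) 0
  unfold excess
  linarith

lemma excess_le_excess (h : S ≤ T) : excess T x ≤ excess S x :=
  max_le_max (by linarith) le_rfl

lemma continuous_excess : Continuous (excess T) :=
  (continuous_abs.sub continuous_const).max continuous_const

lemma continuous_clip : Continuous (clip T) :=
  continuous_const.max (continuous_id.min continuous_const)

lemma abs_clip_le (hT : 0 ≤ T) : |clip T x| ≤ T :=
  abs_le.2 ⟨le_max_left _ _, max_le (by linarith) (min_le_right _ _)⟩

lemma abs_sub_clip (hT : 0 ≤ T) : |x - clip T x| = excess T x := by
  unfold clip excess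
  rcases le_total x T with h1 | h1 <;> rcases le_total (-T) x with h2 | h2
  · rw [min_eq_left h1, max_eq_right h2, sub_self, abs_zero, max_eq_right]
    linarith [abs_le.2 ⟨h2, h1⟩]
  · rw [min_eq_left h1, max_eq_left h2, abs_of_nonpos (by linarith), abs_of_nonpos (by linarith),
      max_eq_left (by linarith)]
    ring
  · rw [min_eq_right h1, max_eq_right (by linarith), abs_of_nonneg (by linarith),
      abs_of_nonneg (by linarith), max_eq_left (by linarith)]
  · rw [min_eq_right h1, max_eq_right (by linarith), abs_of_nonneg (by linarith),
      abs_of_nonneg (by linarith), max_eq_left (by linarith)]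

lemma excess_le_sq (hT : 0 < T) : T * excess T x ≤ 2 * excess (T / 2) x ^ 2 := by
  unfold excess
  rcases le_total (|x|) T with h | h
  · rw [max_eq_right (by linarith), mul_zero]
    positivity
  · rw [max_eq_left (by linarith), max_eq_left (by linarith)]
    nlinarith [sq_nonneg (|x| - T)]

lemma clip_eq_sub (hT : 0 ≤ T) : clip T x = min (max x 0) T - min (max (-x) 0) T := by
  unfold clip
  rcases le_total x 0 with h | h
  · rw [max_eq_right h, min_eq_left hT, max_eq_left (by linarith : 0 ≤ -x),
      min_eq_left (by linarith : x ≤ T), zero_sub]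
    rcases le_total (-x) T with h' | h'
    · rw [min_eq_left h', max_eq_right (by linarith)]; ring
    · rw [min_eq_right h', max_eq_left (by linarith)]
  · rw [max_eq_left h, max_eq_right (by linarith : -x ≤ 0), min_eq_left hT, sub_zero,
      max_eq_right]
    exact le_min (by linarith) (by linarith)

lemma excess_sum_sq_le {ι : Type*} (s : Finset ι) (a y : ι → ℝ) (ha : ∑ i ∈ s, |a i| ≤ 1)
    (hS : 0 ≤ S) :
    excess S (∑ i ∈ s, a i * y i) ^ 2 ≤ ∑ i ∈ s, |a i| * excess S (y i) ^ 2 := by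
  have h1 : excess S (∑ i ∈ s, a i * y i) ≤ ∑ i ∈ s, |a i| * excess S (y i) := by
    refine max_le ?_ (Finset.sum_nonneg fun i _ => mul_nonneg (abs_nonneg _) excess_nonneg)
    have : |∑ i ∈ s, a i * y i| ≤ ∑ i ∈ s, |a i| * (S + excess S (y i)) := by
      refine (Finset.abs_sum_le_sum_abs _ _).trans (Finset.sum_le_sum fun i _ => ?_)
      rw [abs_mul]
      exact mul_le_mul_of_nonneg_left abs_le_add_excess (abs_nonneg _)
    simp_rw [mul_add] at this
    rw [Finset.sum_add_distrib, ← Finset.sum_mul] at this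
    nlinarith
  calc excess S (∑ i ∈ s, a i * y i) ^ 2 ≤ (∑ i ∈ s, |a i| * excess S (y i)) ^ 2 := by
        gcongr; exact excess_nonneg
    _ ≤ (∑ i ∈ s, |a i|) * ∑ i ∈ s, |a i| * excess S (y i) ^ 2 :=
        Finset.sum_sq_le_sum_mul_sum_of_sq_le_mul s (fun i _ => abs_nonneg _)
          (fun i _ => by positivity) fun i _ => by apply le_of_eq; ring
    _ ≤ 1 * ∑ i ∈ s, |a i| * excess S (y i) ^ 2 := by
        gcongr
    _ = _ := one_mul _

end ExcessClip

section Mon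

variable {M : ℝ} {p : ℝ≥0∞} {μ : Measure ℝ} {g : ℝ → ℝ}

/-- A function which is monotone on some order-connected set and vanishes elsewhere. -/
def MonoOnZeroOff (g : ℝ → ℝ) : Prop :=
  ∃ I : Set ℝ, I.OrdConnected ∧ (MonotoneOn g I ∨ AntitoneOn g I) ∧ ∀ x ∉ I, g x = 0

lemma Mon.monoOnZeroOff (hg : Mon M p μ g) : MonoOnZeroOff g := by
  obtain ⟨⟨I, -, h⟩, -⟩ := hg
  exact ⟨I, h⟩

namespace MonoOnZeroOff

lemma neg (hg : MonoOnZeroOff g) : MonoOnZeroOff fun x => -g x := by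
  obtain ⟨I, hI, hm, h0⟩ := hg
  exact ⟨I, hI, hm.symm.imp (fun h => h.neg) fun h => h.neg, fun x hx => by simp [h0 x hx]⟩

lemma ordConnected_superlevel (hg : MonoOnZeroOff g) {t : ℝ} (ht : 0 < t) :
    {x | t ≤ g x}.OrdConnected := by
  obtain ⟨I, hI, hm, h0⟩ := hg
  have hmem : ∀ x, t ≤ g x → x ∈ I := fun x hx => by
    by_contra h
    rw [h0 x h] at hx
    linarith
  refine ⟨fun x hx y hy z hz => ?_⟩
  have hxI := hmem x hx
  have hyI := hmem y hy
  have hzI := hI.out hxI hyI hz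
  rcases hm with hm | hm
  · exact le_trans hx (hm hxI hzI hz.1)
  · exact le_trans hy (hm hzI hyI hz.2)

lemma measurable (hg : MonoOnZeroOff g) : Measurable g := by
  have key : ∀ {h : ℝ → ℝ}, MonoOnZeroOff h → Measurable fun x => max (h x) 0 := fun {h} hh => by
    refine measurable_of_Ici fun t => ?_
    rcases le_or_gt t 0 with ht | ht
    · convert MeasurableSet.univ
      ext x
      simp [ht]
    · convert (hh.ordConnected_superlevel ht).measurableSet
      ext x
      simp [not_le.2 ht]
  convert (key hg).sub (key hg.neg) using 1
  ext x
  simp only [Pi.sub_apply]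
  rcases le_total (g x) 0 with h | h <;> simp [h]

lemma meanDev_clip_le [IsProbabilityMeasure μ] (hg : MonoOnZeroOff g) {A : (ℝ → ℝ) → ℝ → ℝ}
    {a T : ℝ} (hA : IsMarkovOp μ A) (ha : ∀ t, meanDev μ A (indic t) ≤ a) (hT : 0 < T) :
    meanDev μ A (fun x => clip T (g x)) ≤ 4 * T * a := by
  have hint : ∀ {h : ℝ → ℝ}, MonoOnZeroOff h → Integrable (fun x => min (max (h x) 0) T) μ :=
    fun {h} hh => Integrable.of_bound
      ((hh.measurable.max measurable_const).min measurable_const).aestronglyMeasurable T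
      (ae_of_all _ fun x => by
        rw [Real.norm_of_nonneg (by positivity)]
        exact min_le_right _ _)
  have hdev : ∀ {h : ℝ → ℝ}, MonoOnZeroOff h →
      meanDev μ A (fun x => min (max (h x) 0) T) ≤ 2 * T * a := fun {h} hh => by
    refine meanDev_le_of_ordConnected_superlevel hA ha hT (hint hh) (fun x => by positivity)
      (fun x => min_le_right _ _) fun t ht => ?_
    rcases le_or_gt t T with htT | htT
    · have e : {x | t ≤ min (max (h x) 0) T} = {x | t ≤ h x} := by
        ext x
        simp [htT, not_le.2 ht]
      rw [e]
      exact hh.ordConnected_superlevel ht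
    · have e : {x | t ≤ min (max (h x) 0) T} = ∅ := by
        ext x
        simp [not_le.2 htT]
      rw [e]
      exact ordConnected_empty
  have e : (fun x => clip T (g x))
      = (fun x => min (max (g x) 0) T) - fun x => min (max (-g x) 0) T := by
    ext x
    exact clip_eq_sub hT.le
  rw [e]
  refine (meanDev_sub_le hA (hint hg) (hint hg.neg)).trans ?_
  linarith [hdev hg, hdev hg.neg]

end MonoOnZeroOff

end Mon

lemma integral_Ioi_add_rpow_of_lt {a S : ℝ} (ha : a < -1) (hS : 0 < S) :
    ∫ t in Ioi (0 : ℝ), (t + S) ^ a = -S ^ (a + 1) / (a + 1) := by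
  have hd : ∀ x ∈ Ici (0 : ℝ), HasDerivAt (fun t => (t + S) ^ (a + 1) / (a + 1)) ((x + S) ^ a) x := by
    intro x hx
    convert! (((hasDerivAt_id _).add_const _).rpow_const _).div_const _ using 1
    · simp [show a + 1 ≠ 0 by linarith]
    left
    linarith [mem_Ici.mp hx, id_eq x]
  have ht : Tendsto (fun t => (t + S) ^ (a + 1) / (a + 1)) atTop (𝓝 (0 / (a + 1))) := by
    rw [← neg_neg (a + 1)]
    exact (tendsto_rpow_neg_atTop (by linarith)).comp
      (tendsto_atTop_add_const_right _ S tendsto_id) |>.div_const _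
  rw [integral_Ioi_of_hasDerivAt_of_tendsto' hd
    (integrableOn_add_rpow_Ioi_of_lt ha (by linarith)) ht]
  simp [neg_div]

section Tail

variable {M : ℝ} {p : ℝ≥0∞} {μ : Measure ℝ} [IsProbabilityMeasure μ] {g : ℝ → ℝ}

lemma lintegral_excess_sq_le_of_tail {r S : ℝ} (hM : 0 < M) (hr : 2 < r) (hS : 0 < S)
    (hg : Measurable g)
    (htail : ∀ t : ℝ, 0 < t → μ {x | t < |g x|} ≤ ENNReal.ofReal (M ^ r * t ^ (-r))) :
    ∫⁻ x, ENNReal.ofReal (excess S (g x) ^ 2) ∂μ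
      ≤ ENNReal.ofReal (2 * M ^ r / (r - 2) * S ^ (2 - r)) := by
  have h := lintegral_rpow_eq_lintegral_meas_lt_mul μ (f := fun x => excess S (g x))
    (ae_of_all _ fun x => excess_nonneg) (continuous_excess.measurable.comp hg).aemeasurable
    (p := 2) two_pos
  simp_rw [Real.rpow_two] at h
  rw [h]
  have hle : ∀ t ∈ Ioi (0 : ℝ),
      μ {x | t < excess S (g x)} * ENNReal.ofReal (t ^ ((2 : ℝ) - 1))
        ≤ ENNReal.ofReal (M ^ r * (t + S) ^ (1 - r)) := fun t ht => by
    rw [mem_Ioi] at ht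
    have hset : {x | t < excess S (g x)} ⊆ {x | t + S < |g x|} := fun x hx => by
      simp only [mem_ofPred_eq, excess, lt_max_iff] at hx ⊢
      rcases hx with hx | hx <;> linarith
    calc μ {x | t < excess S (g x)} * ENNReal.ofReal (t ^ ((2 : ℝ) - 1))
        ≤ ENNReal.ofReal (M ^ r * (t + S) ^ (-r)) * ENNReal.ofReal (t + S) := by
          gcongr
          · exact (measure_mono hset).trans (htail _ (by linarith))
          · norm_num
            exact hS.le
      _ = ENNReal.ofReal (M ^ r * (t + S) ^ (1 - r)) := by
          rw [← ENNReal.ofReal_mul (by positivity), mul_assoc]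
          congr 2
          rw [sub_eq_add_neg, Real.rpow_add (by linarith), Real.rpow_one, mul_comm]
  have hint : IntegrableOn (fun t => M ^ r * (t + S) ^ (1 - r)) (Ioi 0) :=
    (integrableOn_add_rpow_Ioi_of_lt (by linarith) (by linarith)).const_mul _
  calc ENNReal.ofReal 2 * ∫⁻ t in Ioi 0,
        μ {x | t < excess S (g x)} * ENNReal.ofReal (t ^ ((2 : ℝ) - 1))
      ≤ ENNReal.ofReal 2 * ∫⁻ t in Ioi 0, ENNReal.ofReal (M ^ r * (t + S) ^ (1 - r)) := by
        gcongr 1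
        exact setLIntegral_mono' measurableSet_Ioi hle
    _ = ENNReal.ofReal (2 * M ^ r / (r - 2) * S ^ (2 - r)) := by
        rw [← ofReal_integral_eq_lintegral_ofReal hint, ← ENNReal.ofReal_mul (by norm_num),
          integral_const_mul, integral_Ioi_add_rpow_of_lt (by linarith) hS]
        · congr 1
          have e1 : 1 - r + 1 = 2 - r := by ring
          have e2 : 2 - r = -(r - 2) := by ring
          rw [e1]
          nth_rewrite 2 [e2]
          rw [neg_div_neg_eq]
          ring
        · filter_upwards [self_mem_ae_restrict measurableSet_Ioi] with t ht
          rw [mem_Ioi] at ht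
          have : 0 ≤ (t + S) ^ (1 - r) := by positivity
          simp only [Pi.zero_apply]
          positivity

lemma exists_truncation_level (hM : 0 < M) (hp : 2 < p) :
    ∃ C : ℝ, 0 ≤ C ∧ ∀ a δ : ℝ, 0 ≤ a → a ≤ 1 → 0 < δ → ∃ T : ℝ, 1 ≤ T ∧
      T ^ 2 * a ≤ C * a ^ (((1 : ℝ≥0∞) - 2 / p).toReal) + δ ∧
      ∀ g, Mon M p μ g → ∫⁻ x, ENNReal.ofReal (excess (T / 2) (g x) ^ 2) ∂μ
        ≤ ENNReal.ofReal (C * a ^ (((1 : ℝ≥0∞) - 2 / p).toReal) + δ) := by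
  rcases eq_or_ne p ∞ with rfl | hp'
  · refine ⟨max 1 (2 * M) ^ 2, by positivity, fun a δ ha ha1 hδ =>
      ⟨max 1 (2 * M), le_max_left _ _, ?_, fun g hg => ?_⟩⟩
    · simp only [ENNReal.div_top, tsub_zero, ENNReal.toReal_one, Real.rpow_one]
      linarith
    · have h0 : ∀ᵐ x ∂μ, |g x| ≤ M := by
        have h := hg.2
        rw [if_pos rfl] at h
        rw [ae_iff]
        simpa using h
      have : ∫⁻ x, ENNReal.ofReal (excess (max 1 (2 * M) / 2) (g x) ^ 2) ∂μ = 0 := by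
        rw [← lintegral_zero (μ := μ)]
        refine lintegral_congr_ae ?_
        filter_upwards [h0] with x hx
        have h1 : |g x| - max 1 (2 * M) / 2 ≤ 0 := by linarith [le_max_right 1 (2 * M)]
        simp [excess, h1]
      rw [this]
      exact zero_le
  · set r := p.toReal with hr
    have hr2 : 2 < r := by
      have := (ENNReal.toReal_lt_toReal (by simp) hp').2 hp
      simpa using this
    have hq : ((1 : ℝ≥0∞) - 2 / p).toReal = 1 - 2 / r := by
      rw [ENNReal.toReal_sub_of_le _ (by simp)]
      · simp [ENNReal.toReal_div, hr]
      · refine ENNReal.div_le_of_le_mul ?_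
        simpa using hp.le
    have hq0 : 0 < 1 - 2 / r := by
      rw [sub_pos, div_lt_one (by linarith)]
      exact hr2
    rw [hq]
    have htail : ∀ g, Mon M p μ g → ∀ T : ℝ, 0 < T →
        ∫⁻ x, ENNReal.ofReal (excess (T / 2) (g x) ^ 2) ∂μ
        ≤ ENNReal.ofReal (2 * M ^ r / (r - 2) * (T / 2) ^ (2 - r)) := fun g hg T hT => by
      have h := hg.2
      rw [if_neg hp'] at h
      exact lintegral_excess_sq_le_of_tail hM hr2 (by linarith) hg.monoOnZeroOff.measurable h
    have hr20 : 0 < r - 2 := by linarith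
    set C₁ := 2 * M ^ r / (r - 2) * (1 / 2) ^ (2 - r) with hC₁
    have hC₁0 : 0 ≤ C₁ := by positivity
    have hC₁T : ∀ T : ℝ, 0 < T →
        2 * M ^ r / (r - 2) * (T / 2) ^ (2 - r) = C₁ * T ^ (2 - r) := fun T hT => by
      rw [hC₁, mul_assoc, ← Real.mul_rpow (by norm_num) hT.le]
      congr 3
      ring
    refine ⟨max 1 C₁, by positivity, fun a δ ha ha1 hδ => ?_⟩
    rcases ha.eq_or_lt with rfl | ha0
    · have hlim : Tendsto (fun T : ℝ => C₁ * T ^ (2 - r)) atTop (𝓝 0) := by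
        rw [← mul_zero C₁, ← neg_sub r 2]
        exact (tendsto_rpow_neg_atTop hr20).const_mul _
      obtain ⟨T, hT1, hT⟩ := ((eventually_ge_atTop (1 : ℝ)).and
        (hlim.eventually (gt_mem_nhds hδ))).exists
      refine ⟨T, hT1, ?_, fun g hg => ?_⟩
      · rw [Real.zero_rpow hq0.ne']
        linarith
      · refine (htail g hg T (by linarith)).trans (ENNReal.ofReal_le_ofReal ?_)
        rw [hC₁T T (by linarith), Real.zero_rpow hq0.ne']
        linarith
    · have hr0 : 0 < r := by linarith
      have hT0 : 0 < a ^ (-(1 / r)) := by positivity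
      refine ⟨a ^ (-(1 / r)), ?_, ?_, fun g hg => ?_⟩
      · exact Real.one_le_rpow_of_pos_of_le_one_of_nonpos ha0 ha1
          (neg_nonpos.2 (by positivity))
      · have e : (a ^ (-(1 / r))) ^ 2 * a = a ^ (1 - 2 / r) := by
          rw [← Real.rpow_natCast, ← Real.rpow_mul ha]
          nth_rewrite 2 [← Real.rpow_one a]
          rw [← Real.rpow_add ha0]
          congr 1
          push_cast
          ring
        rw [e]
        have : 1 * a ^ (1 - 2 / r) ≤ max 1 C₁ * a ^ (1 - 2 / r) := by
          gcongr
          exact le_max_left _ _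
        linarith
      · refine (htail g hg _ hT0).trans (ENNReal.ofReal_le_ofReal ?_)
        rw [hC₁T _ hT0, ← Real.rpow_mul ha]
        have e : -(1 / r) * (2 - r) = 1 - 2 / r := by field_simp; ring
        rw [e]
        have : C₁ * a ^ (1 - 2 / r) ≤ max 1 C₁ * a ^ (1 - 2 / r) := by
          gcongr
          exact le_max_right _ _
        linarith

end Tail

section ExcessIntegral

variable {α : Type*} [MeasurableSpace α] {μ : Measure α} [IsProbabilityMeasure μ]
  {S T τ : ℝ} {h : α → ℝ}

lemma integral_excess_sq_le (hτ : 0 ≤ τ) (hh : AEStronglyMeasurable h μ)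
    (hb : ∫⁻ x, ENNReal.ofReal (excess S (h x) ^ 2) ∂μ ≤ ENNReal.ofReal τ) :
    ∫ x, excess S (h x) ^ 2 ∂μ ≤ τ := by
  rw [integral_eq_lintegral_of_nonneg_ae (ae_of_all _ fun x => sq_nonneg _)
    ((continuous_excess.comp_aestronglyMeasurable hh).pow 2)]
  exact ENNReal.toReal_le_of_le_ofReal hτ hb

lemma memLp_two_excess (hh : AEStronglyMeasurable h μ)
    (hb : ∫⁻ x, ENNReal.ofReal (excess S (h x) ^ 2) ∂μ ≤ ENNReal.ofReal τ) :
    MemLp (fun x => excess S (h x)) 2 μ := by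
  have hm := continuous_excess.comp_aestronglyMeasurable (g := excess S) hh
  rw [memLp_two_iff_integrable_sq hm]
  refine ⟨hm.pow 2, ?_⟩
  rw [hasFiniteIntegral_iff_ofReal (ae_of_all _ fun x => sq_nonneg _)]
  exact hb.trans_lt ENNReal.ofReal_lt_top

lemma memLp_two_of_lintegral_excess (hh : AEStronglyMeasurable h μ)
    (hb : ∫⁻ x, ENNReal.ofReal (excess S (h x) ^ 2) ∂μ ≤ ENNReal.ofReal τ) :
    MemLp h 2 μ :=
  ((memLp_const S).add (memLp_two_excess hh hb)).mono hh (ae_of_all _ fun x => by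
    rw [Pi.add_apply, Real.norm_eq_abs, Real.norm_eq_abs]
    exact abs_le_add_excess.trans (le_abs_self _))

lemma mul_integral_excess_le (hT : 0 < T) (hτ : 0 ≤ τ) (hh : AEStronglyMeasurable h μ)
    (hb : ∫⁻ x, ENNReal.ofReal (excess (T / 2) (h x) ^ 2) ∂μ ≤ ENNReal.ofReal τ) :
    T * ∫ x, excess T (h x) ∂μ ≤ 2 * τ := by
  rw [← integral_const_mul]
  calc ∫ x, T * excess T (h x) ∂μ ≤ ∫ x, 2 * excess (T / 2) (h x) ^ 2 ∂μ := by
        refine integral_mono_of_nonneg (ae_of_all _ fun x => mul_nonneg hT.le excess_nonneg)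
          ((memLp_two_excess hh hb).integrable_sq.const_mul 2)
          (ae_of_all _ fun x => excess_le_sq hT)
    _ ≤ 2 * τ := by
        rw [integral_const_mul]
        gcongr
        exact integral_excess_sq_le hτ hh hb

lemma lintegral_excess_sum_sq_le {ι : Type*} (s : Finset ι) (a : ι → ℝ) (g : ι → α → ℝ)
    (ha : ∑ i ∈ s, |a i| ≤ 1) (hS : 0 ≤ S) (hg : ∀ i, Measurable (g i))
    (hb : ∀ i, ∫⁻ x, ENNReal.ofReal (excess S (g i x) ^ 2) ∂μ ≤ ENNReal.ofReal τ) :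
    ∫⁻ x, ENNReal.ofReal (excess S (∑ i ∈ s, a i * g i x) ^ 2) ∂μ ≤ ENNReal.ofReal τ := by
  have hm : ∀ i, Measurable fun x => ENNReal.ofReal (excess S (g i x) ^ 2) := fun i =>
    ((continuous_excess.measurable.comp (hg i)).pow_const 2).ennreal_ofReal
  calc ∫⁻ x, ENNReal.ofReal (excess S (∑ i ∈ s, a i * g i x) ^ 2) ∂μ
      ≤ ∫⁻ x, ∑ i ∈ s, ENNReal.ofReal |a i| * ENNReal.ofReal (excess S (g i x) ^ 2) ∂μ := by
        refine lintegral_mono fun x => ?_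
        simp_rw [← ENNReal.ofReal_mul (abs_nonneg _)]
        rw [← ENNReal.ofReal_sum_of_nonneg fun i _ => by positivity]
        exact ENNReal.ofReal_le_ofReal (excess_sum_sq_le s a _ ha hS)
    _ = ∑ i ∈ s, ENNReal.ofReal |a i| * ∫⁻ x, ENNReal.ofReal (excess S (g i x) ^ 2) ∂μ := by
        rw [lintegral_finsetSum _ fun i _ => (hm i).const_mul _]
        simp_rw [lintegral_const_mul _ (hm _)]
    _ ≤ ∑ i ∈ s, ENNReal.ofReal |a i| * ENNReal.ofReal τ := by
        gcongr with i _
        exact hb i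
    _ = ENNReal.ofReal (∑ i ∈ s, |a i|) * ENNReal.ofReal τ := by
        rw [ENNReal.ofReal_sum_of_nonneg fun i _ => abs_nonneg _, Finset.sum_mul]
    _ ≤ 1 * ENNReal.ofReal τ := by
        gcongr
        exact ENNReal.ofReal_le_one.2 ha
    _ = _ := one_mul _

lemma lintegral_excess_sq_le_of_tendsto {φ : ℕ → α → ℝ} (hh : Integrable h μ)
    (hφ : ∀ n, Integrable (φ n) μ)
    (hlim : Tendsto (fun n => ∫ x, |h x - φ n x| ∂μ) atTop (𝓝 0))
    (hb : ∀ n, ∫⁻ x, ENNReal.ofReal (excess S (φ n x) ^ 2) ∂μ ≤ ENNReal.ofReal τ) :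
    ∫⁻ x, ENNReal.ofReal (excess S (h x) ^ 2) ∂μ ≤ ENNReal.ofReal τ := by
  have hL : Tendsto (fun n => eLpNorm (φ n - h) 1 μ) atTop (𝓝 0) := by
    have e : ∀ n, eLpNorm (φ n - h) 1 μ = ENNReal.ofReal (∫ x, |h x - φ n x| ∂μ) := fun n => by
      rw [eLpNorm_one_eq_lintegral_enorm,
        ofReal_integral_eq_lintegral_ofReal (f := fun x => |h x - φ n x|) (hh.sub (hφ n)).abs
          (ae_of_all _ fun x => abs_nonneg _)]
      refine lintegral_congr fun x => ?_
      rw [Pi.sub_apply, abs_sub_comm, Real.enorm_eq_ofReal_abs]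
    simp_rw [e]
    simpa using ENNReal.tendsto_ofReal hlim
  obtain ⟨ns, -, hns⟩ := (tendstoInMeasure_of_tendsto_eLpNorm one_ne_zero
    (fun n => (hφ n).aestronglyMeasurable) hh.aestronglyMeasurable hL).exists_seq_tendsto_ae
  have hm : ∀ n, AEMeasurable (fun x => ENNReal.ofReal (excess S (φ (ns n) x) ^ 2)) μ := fun n =>
    ((continuous_excess.measurable.comp_aemeasurable (hφ _).aemeasurable).pow_const 2).ennreal_ofReal
  calc ∫⁻ x, ENNReal.ofReal (excess S (h x) ^ 2) ∂μ
      = ∫⁻ x, liminf (fun n => ENNReal.ofReal (excess S (φ (ns n) x) ^ 2)) atTop ∂μ := by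
        refine lintegral_congr_ae ?_
        filter_upwards [hns] with x hx
        exact ((ENNReal.tendsto_ofReal
          (((continuous_excess.tendsto _).comp hx).pow 2)).liminf_eq).symm
    _ ≤ liminf (fun n => ∫⁻ x, ENNReal.ofReal (excess S (φ (ns n) x) ^ 2) ∂μ) atTop :=
        lintegral_liminf_le' hm
    _ ≤ liminf (fun _ : ℕ => ENNReal.ofReal τ) atTop :=
        liminf_le_liminf (Eventually.of_forall fun n => hb _)
    _ = _ := liminf_const _

end ExcessIntegral

section ClassC

variable {M : ℝ} {p : ℝ≥0∞} {μ : Measure ℝ} [IsProbabilityMeasure μ] {f : ℝ → ℝ}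
  {A : (ℝ → ℝ) → ℝ → ℝ} {a T τ : ℝ}

lemma meanDev_sum_monoOnZeroOff_le {n : ℕ} {b : Fin n → ℝ} {g : Fin n → ℝ → ℝ}
    (hA : IsMarkovOp μ A) (ha : ∀ t, meanDev μ A (indic t) ≤ a) (hT : 0 < T) (hτ : 0 ≤ τ)
    (hTa : T ^ 2 * a ≤ τ) (hb : ∑ i, |b i| ≤ 1) (hg : ∀ i, MonoOnZeroOff (g i))
    (hgτ : ∀ i, ∫⁻ x, ENNReal.ofReal (excess (T / 2) (g i x) ^ 2) ∂μ ≤ ENNReal.ofReal τ) :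
    T * meanDev μ A (fun x => ∑ i, b i * g i x) ≤ 8 * τ := by
  have hgm : ∀ i, AEStronglyMeasurable (g i) μ := fun i => (hg i).measurable.aestronglyMeasurable
  have hgi : ∀ i, Integrable (g i) μ := fun i =>
    (memLp_two_of_lintegral_excess (hgm i) (hgτ i)).integrable one_le_two
  have hci : ∀ i, Integrable (fun x => clip T (g i x)) μ := fun i =>
    Integrable.of_bound (continuous_clip.comp_aestronglyMeasurable (hgm i)) T
      (ae_of_all _ fun x => abs_clip_le hT.le)
  have hdev : ∀ i, T * meanDev μ A (g i) ≤ 8 * τ := fun i => by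
    have h1 := meanDev_le_add hA (hgi i) (hci i)
    simp_rw [abs_sub_clip hT.le] at h1
    have h2 := (hg i).meanDev_clip_le hA ha hT
    have h3 := mul_integral_excess_le hT hτ (hgm i) (hgτ i)
    nlinarith
  have e : (fun x => ∑ i, b i * g i x) = ∑ i, b i • g i := by
    ext x
    simp
  rw [e]
  calc T * meanDev μ A (∑ i, b i • g i) ≤ T * ∑ i, meanDev μ A (b i • g i) := by
        gcongr
        exact meanDev_sum_le hA _ fun i _ => (hgi i).smul (b i)
    _ = ∑ i, |b i| * (T * meanDev μ A (g i)) := by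
        rw [Finset.mul_sum]
        refine Finset.sum_congr rfl fun i _ => ?_
        rw [meanDev_smul hA _ (hgi i)]
        ring
    _ ≤ ∑ i, |b i| * (8 * τ) := by
        exact Finset.sum_le_sum fun i _ => mul_le_mul_of_nonneg_left (hdev i) (abs_nonneg _)
    _ = (∑ i, |b i|) * (8 * τ) := by rw [Finset.sum_mul]
    _ ≤ 1 * (8 * τ) := by gcongr
    _ = _ := one_mul _

lemma ClassC.exists_truncation_level (hM : 0 < M) (hp : 2 < p) (hf : ClassC M p μ f) :
    ∃ C : ℝ, 0 ≤ C ∧ ∀ a δ : ℝ, 0 ≤ a → a ≤ 1 → 0 < δ → ∃ T : ℝ, 1 ≤ T ∧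
      ∫⁻ x, ENNReal.ofReal (excess (T / 2) (f x) ^ 2) ∂μ
        ≤ ENNReal.ofReal (C * a ^ (((1 : ℝ≥0∞) - 2 / p).toReal) + δ) ∧
      ∀ A, IsMarkovOp μ A → (∀ t, meanDev μ A (indic t) ≤ a) →
        T * meanDev μ A f ≤ 8 * (C * a ^ (((1 : ℝ≥0∞) - 2 / p).toReal) + δ) := by
  obtain ⟨C, hC, h⟩ := _root_.exists_truncation_level (μ := μ) hM hp
  refine ⟨C, hC, fun a δ ha ha1 hδ => ?_⟩
  obtain ⟨T, hT1, hTa, hTg⟩ := h a δ ha ha1 hδ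
  have hT0 : 0 < T := by linarith
  set τ := C * a ^ (((1 : ℝ≥0∞) - 2 / p).toReal) + δ with hτdef
  have hτ : 0 ≤ τ := by positivity
  choose m b g hb hg happ using fun n : ℕ => hf.2 (1 / ((n : ℝ) + 1)) (by positivity)
  have hgm : ∀ n i, Measurable (g n i) := fun n i => (hg n i).monoOnZeroOff.measurable
  have hgi : ∀ n i, Integrable (g n i) μ := fun n i =>
    (memLp_two_of_lintegral_excess (hgm n i).aestronglyMeasurable
      (hTg _ (hg n i))).integrable one_le_two
  have hφi : ∀ n, Integrable (fun x => ∑ i, b n i * g n i x) μ := fun n =>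
    integrable_finsetSum _ fun i _ => (hgi n i).const_mul _
  have hlim : Tendsto (fun n => ∫ x, |f x - ∑ i, b n i * g n i x| ∂μ) atTop (𝓝 0) :=
    squeeze_zero (fun n => integral_nonneg fun x => abs_nonneg _) (fun n => (happ n).le)
      tendsto_one_div_add_atTop_nhds_zero_nat
  refine ⟨T, hT1, ?_, fun A hA hAa => ?_⟩
  · exact lintegral_excess_sq_le_of_tendsto hf.1 hφi hlim fun n =>
      lintegral_excess_sum_sq_le _ _ _ (hb n) (by linarith) (hgm n) fun i => hTg _ (hg n i)
  · have hle : ∀ n, T * meanDev μ A f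
        ≤ 8 * τ + T * (2 * ∫ x, |f x - ∑ i, b n i * g n i x| ∂μ) := fun n => by
      have h1 := meanDev_le_add hA hf.1 (hφi n)
      have h2 := meanDev_sum_monoOnZeroOff_le hA hAa hT0 hτ hTa (hb n)
        (fun i => (hg n i).monoOnZeroOff) fun i => hTg _ (hg n i)
      nlinarith
    have h2 := ((hlim.const_mul 2).const_mul T).const_add (8 * τ)
    rw [mul_zero, mul_zero, add_zero] at h2
    exact ge_of_tendsto' h2 hle

end ClassC

section Covariance

variable {α : Type*} [MeasurableSpace α] {μ : Measure α} [IsProbabilityMeasure μ]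
  {A B D : (α → ℝ) → α → ℝ} {T τ : ℝ} {f : α → ℝ}

lemma abs_integral_mul_dev_le (hB : IsMarkovOp μ B) (hD : IsMarkovOp μ D) (hT : 0 < T)
    (hτ : 0 ≤ τ) (hf : AEStronglyMeasurable f μ)
    (hb : ∫⁻ x, ENNReal.ofReal (excess (T / 2) (f x) ^ 2) ∂μ ≤ ENNReal.ofReal τ)
    (hDf : T * meanDev μ D f ≤ 8 * τ) :
    |∫ x, B f x * (D f x - ∫ y, f y ∂μ) ∂μ| ≤ 15 * τ := by
  have hf2 : MemLp f 2 μ := memLp_two_of_lintegral_excess hf hb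
  set w : α → ℝ := fun x => clip T (f x) with hw
  set r : α → ℝ := fun x => f x - w x with hr
  have hwm : AEStronglyMeasurable w μ := continuous_clip.comp_aestronglyMeasurable hf
  have hw2 : MemLp w 2 μ := MemLp.of_bound hwm T (ae_of_all _ fun x => abs_clip_le hT.le)
  have hr2 : MemLp r 2 μ := hf2.sub hw2
  have hw1 := hw2.integrable one_le_two
  have hr1 := hr2.integrable one_le_two
  have hf1 := hf2.integrable one_le_two
  have hrabs : ∀ x, |r x| = excess T (f x) := fun x => abs_sub_clip hT.le
  have hr1b : T * ∫ x, |r x| ∂μ ≤ 2 * τ := by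
    simp_rw [hrabs]
    exact mul_integral_excess_le hT hτ hf hb
  have hr2b : ∫ x, r x ^ 2 ∂μ ≤ τ := by
    refine le_trans ?_ (integral_excess_sq_le hτ hf hb)
    refine integral_mono hr2.integrable_sq (memLp_two_excess hf hb).integrable_sq fun x => ?_
    simp only
    rw [← sq_abs, hrabs]
    gcongr
    · exact excess_nonneg
    · exact excess_le_excess (by linarith)
  have hadd : ∀ {E : (α → ℝ) → α → ℝ}, IsMarkovOp μ E → ∀ᵐ x ∂μ, E f x = E w x + E r x :=
    fun {E} hE => by
      have e : f = w + r := by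
        ext x
        simp [hr]
      have h := hE.add hw1 hr1
      rw [← e] at h
      exact h
  have hintf : ∫ y, f y ∂μ = ∫ y, w y ∂μ + ∫ y, r y ∂μ := by
    rw [← integral_add hw1 hr1]
    simp [hr]
  set m := ∫ y, f y ∂μ
  set mw := ∫ y, w y ∂μ
  set mr := ∫ y, r y ∂μ
  have hBw := hB.memLp_two hw2
  have hBr := hB.memLp_two hr2
  have hDr := hD.memLp_two hr2
  have hDfm : MemLp (fun x => D f x - m) 2 μ := (hD.memLp_two hf2).sub (memLp_const _)
  have hDwm : MemLp (fun x => D w x - mw) 2 μ := (hD.memLp_two hw2).sub (memLp_const _)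
  have hDrm : MemLp (fun x => D r x - mr) 2 μ := hDr.sub (memLp_const _)
  have i1 : Integrable (fun x => B w x * (D f x - m)) μ := hBw.integrable_mul hDfm
  have i2 : Integrable (fun x => B r x * (D w x - mw)) μ := hBr.integrable_mul hDwm
  have i3 : Integrable (fun x => B r x * (D r x - mr)) μ := hBr.integrable_mul hDrm
  have i12 : Integrable (fun x => B w x * (D f x - m) + B r x * (D w x - mw)) μ := i1.add i2
  have hsplit : ∫ x, B f x * (D f x - m) ∂μ = ∫ x, B w x * (D f x - m) ∂μ
      + ∫ x, B r x * (D w x - mw) ∂μ + ∫ x, B r x * (D r x - mr) ∂μ := by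
    rw [← integral_add i1 i2, ← integral_add i12 i3]
    refine integral_congr_ae ?_
    filter_upwards [hadd hB, hadd hD] with x h1 h2
    rw [h1, h2, hintf]
    ring
  have b1 : |∫ x, B w x * (D f x - m) ∂μ| ≤ 8 * τ := by
    refine (abs_integral_le_integral_abs).trans (le_trans ?_ hDf)
    rw [meanDev, ← integral_const_mul]
    refine integral_mono_ae i1.abs (((hDfm.integrable one_le_two).abs).const_mul T) ?_
    filter_upwards [hB.abs_le_const hw1 (ae_of_all _ fun x => abs_clip_le hT.le)] with x hx
    rw [abs_mul]
    gcongr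
  have b2 : |∫ x, B r x * (D w x - mw) ∂μ| ≤ 4 * τ := by
    have hmw : |mw| ≤ T := by
      refine (abs_integral_le_integral_abs).trans ?_
      have h := integral_mono hw1.abs (integrable_const T) fun x => abs_clip_le (x := f x) hT.le
      simpa using h
    calc |∫ x, B r x * (D w x - mw) ∂μ| ≤ ∫ x, |B r x * (D w x - mw)| ∂μ :=
          abs_integral_le_integral_abs
      _ ≤ ∫ x, |B r x| * (2 * T) ∂μ := by
          refine integral_mono_ae i2.abs
            (((hBr.integrable one_le_two).abs).mul_const (2 * T)) ?_
          filter_upwards [hD.abs_le_const hw1 (ae_of_all _ fun x => abs_clip_le hT.le)] with x hx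
          rw [abs_mul]
          gcongr
          exact (abs_sub _ _).trans (by linarith)
      _ = (∫ x, |B r x| ∂μ) * (2 * T) := integral_mul_const _ _
      _ ≤ (∫ x, |r x| ∂μ) * (2 * T) := by
          exact mul_le_mul_of_nonneg_right (hB.integral_abs_le hr1) (by positivity)
      _ ≤ 4 * τ := by linarith
  have b3 : |∫ x, B r x * (D r x - mr) ∂μ| ≤ 3 * τ := by
    have hmr : mr ^ 2 ≤ τ := (sq_integral_le_integral_sq hr2).trans hr2b
    have i4 : Integrable (fun x => B r x ^ 2 + D r x ^ 2) μ :=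
      hBr.integrable_sq.add hDr.integrable_sq
    calc |∫ x, B r x * (D r x - mr) ∂μ| ≤ ∫ x, |B r x * (D r x - mr)| ∂μ :=
          abs_integral_le_integral_abs
      _ ≤ ∫ x, (B r x ^ 2 + D r x ^ 2 + mr ^ 2) ∂μ := by
          refine integral_mono i3.abs
            (i4.add (integrable_const _)) fun x => ?_
          simp only [abs_le]
          constructor <;> nlinarith [sq_nonneg (B r x + D r x), sq_nonneg (B r x - D r x),
            sq_nonneg (B r x + mr), sq_nonneg (B r x - mr), sq_nonneg (D r x), sq_nonneg mr]
      _ = ∫ x, B r x ^ 2 ∂μ + ∫ x, D r x ^ 2 ∂μ + mr ^ 2 := by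
          rw [integral_add i4 (integrable_const _),
            integral_add hBr.integrable_sq hDr.integrable_sq]
          simp
      _ ≤ 3 * τ := by
          have := hB.integral_sq_le hr2
          have := hD.integral_sq_le hr2
          linarith
  rw [hsplit]
  have h1 := abs_add_le (∫ x, B w x * (D f x - m) ∂μ + ∫ x, B r x * (D w x - mw) ∂μ)
    (∫ x, B r x * (D r x - mr) ∂μ)
  have h2 := abs_add_le (∫ x, B w x * (D f x - m) ∂μ) (∫ x, B r x * (D w x - mw) ∂μ)
  linarith

end Covariance

section Alpha

variable {μ : Measure ℝ} [IsProbabilityMeasure μ] {A : (ℝ → ℝ) → ℝ → ℝ} {M : ℝ} {p : ℝ≥0∞}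
  {f : ℝ → ℝ}

lemma meanDev_indic_le_one (hA : IsMarkovOp μ A) (t : ℝ) : meanDev μ A (indic t) ≤ 1 := by
  have hi : Integrable (indic t) μ := integrable_indic t
  have h0 : ∀ x, 0 ≤ indic t x := fun x => indicator_nonneg (fun _ _ => zero_le_one) x
  have h1 : ∀ x, indic t x ≤ 1 := fun x => indicator_le_self' (fun _ _ => zero_le_one) x
  have m0 : 0 ≤ ∫ y, indic t y ∂μ := integral_nonneg h0
  have m1 : ∫ y, indic t y ∂μ ≤ 1 := by
    simpa using integral_mono hi (integrable_const 1) h1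
  have h : meanDev μ A (indic t) ≤ ∫ _, (1 : ℝ) ∂μ := by
    refine integral_mono_ae (hA.integrable_dev hi).abs (integrable_const 1) ?_
    filter_upwards [hA.mono (integrable_const 0) hi (ae_of_all _ h0),
      hA.mono hi (integrable_const 1) (ae_of_all _ h1), hA.const 0, hA.const 1] with x h2 h3 h4 h5
    rw [h4] at h2
    rw [h5] at h3
    rw [abs_le]
    constructor <;> linarith
  simpa using h

lemma alpha1_eq_iSup_meanDev (n : ℕ) : alpha1 A μ n = ⨆ t, meanDev μ A^[n] (indic t) := rfl

lemma meanDev_indic_le_alpha1 (hA : IsMarkovOp μ A) (n : ℕ) (t : ℝ) :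
    meanDev μ A^[n] (indic t) ≤ alpha1 A μ n := by
  rw [alpha1_eq_iSup_meanDev]
  refine le_ciSup (f := fun t => meanDev μ A^[n] (indic t)) ⟨1, ?_⟩ t
  rintro _ ⟨s, rfl⟩
  exact meanDev_indic_le_one (hA.iterate n) s

lemma alpha1_nonneg (n : ℕ) : 0 ≤ alpha1 A μ n := Real.iSup_nonneg fun _ => meanDev_nonneg

lemma alpha1_le_one (hA : IsMarkovOp μ A) (n : ℕ) : alpha1 A μ n ≤ 1 :=
  ciSup_le fun t => meanDev_indic_le_one (hA.iterate n) t

lemma ClassC.memLp_two (hM : 0 < M) (hp : 2 < p) (hf : ClassC M p μ f) : MemLp f 2 μ := by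
  obtain ⟨C, -, h⟩ := hf.exists_truncation_level hM hp
  obtain ⟨T, -, hT, -⟩ := h 0 1 le_rfl zero_le_one one_pos
  exact memLp_two_of_lintegral_excess hf.1.aestronglyMeasurable hT

/-- Decay of `K^N f` and of the associated covariances at the rate `α₁(N)^((p-2)/p)`. -/
lemma ClassC.exists_decay_const (hA : IsMarkovOp μ A) (hM : 0 < M) (hp : 2 < p)
    (hf : ClassC M p μ f) :
    ∃ C : ℝ, 0 ≤ C ∧ ∀ N : ℕ,
      meanDev μ A^[N] f ≤ C * alpha1 A μ N ^ (((1 : ℝ≥0∞) - 2 / p).toReal) ∧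
      ∀ k : ℕ, |∫ x, A^[k] f x * (A^[N] f x - ∫ y, f y ∂μ) ∂μ|
        ≤ C * alpha1 A μ N ^ (((1 : ℝ≥0∞) - 2 / p).toReal) := by
  obtain ⟨C, hC, h⟩ := hf.exists_truncation_level hM hp
  refine ⟨15 * C, by positivity, fun N => ?_⟩
  set b := alpha1 A μ N ^ (((1 : ℝ≥0∞) - 2 / p).toReal) with hb
  have hb0 : 0 ≤ b := Real.rpow_nonneg (alpha1_nonneg N) _
  have key : ∀ δ : ℝ, 0 < δ → meanDev μ A^[N] f ≤ 15 * (C * b + δ) ∧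
      ∀ k : ℕ, |∫ x, A^[k] f x * (A^[N] f x - ∫ y, f y ∂μ) ∂μ| ≤ 15 * (C * b + δ) :=
    fun δ hδ => by
      obtain ⟨T, hT1, hT, hdev⟩ := h _ δ (alpha1_nonneg (A := A) (μ := μ) N)
        (alpha1_le_one hA N) hδ
      have h8 := hdev _ (hA.iterate N) (meanDev_indic_le_alpha1 hA N)
      rw [← hb] at h8 hT
      have hτ : 0 ≤ C * b + δ := by positivity
      refine ⟨?_, fun k => abs_integral_mul_dev_le (hA.iterate k) (hA.iterate N) (by linarith) hτ
        hf.1.aestronglyMeasurable hT h8⟩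
      have : 1 * meanDev μ A^[N] f ≤ T * meanDev μ A^[N] f := by
        gcongr
        exact meanDev_nonneg
      linarith
  refine ⟨le_of_forall_pos_le_add fun ε hε => ?_, fun k => le_of_forall_pos_le_add fun ε hε => ?_⟩
  · linarith [(key (ε / 15) (by positivity)).1]
  · linarith [(key (ε / 15) (by positivity)).2 k]

end Alpha

lemma exists_lt_and_mul_lt_of_summable {b : ℕ → ℝ} (hb : Summable b) {ε : ℝ} (hε : 0 < ε)
    {P : ℕ → Prop} (hP : ∀ᶠ n in atTop, P n) :
    ∃ n, P n ∧ ((n : ℝ) + 1) * b n < ε := by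
  by_contra! h
  refine Real.not_summable_one_div_natCast ?_
  obtain ⟨n₀, hn₀⟩ := eventually_atTop.1 hP
  rw [← summable_nat_add_iff 1]
  refine Summable.of_norm_bounded_eventually_nat (hb.mul_left ε⁻¹)
    (eventually_atTop.2 ⟨n₀, fun n hn => ?_⟩)
  have h1 := h n (hn₀ n hn)
  rw [Real.norm_of_nonneg (by positivity), le_inv_mul_iff₀ hε]
  push_cast
  rw [mul_one_div, div_le_iff₀ (by positivity)]
  linarith

section Corrector

variable {α : Type*} [MeasurableSpace α] {μ : Measure α} [IsProbabilityMeasure μ]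
  {A : (α → ℝ) → α → ℝ} {f : α → ℝ}

lemma IsMarkovOp.apply_sub_const (hA : IsMarkovOp μ A) (hf : Integrable f μ) (m : ℝ) :
    A (fun x => f x - m) =ᵐ[μ] fun x => A f x - m := by
  have h := hA.sub hf (integrable_const m)
  filter_upwards [h, hA.const m] with x h1 h2
  have e : (f - fun _ => m) = fun x => f x - m := rfl
  rw [e] at h1
  rw [h1, Pi.sub_apply, h2]

/-- The partial sums `∑_{k < N} A^k f₀` of the solution to Poisson's equation `f₀ = g - A g`. -/
def poissonSum (A : (α → ℝ) → α → ℝ) (f₀ : α → ℝ) (N : ℕ) : α → ℝ :=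
  ∑ k ∈ Finset.range N, A^[k] f₀

lemma memLp_two_poissonSum (hA : IsMarkovOp μ A) (hf : MemLp f 2 μ) (N : ℕ) :
    MemLp (poissonSum A f N) 2 μ :=
  memLp_finsetSum' _ fun k _ => (hA.iterate k).memLp_two hf

lemma apply_poissonSum (hA : IsMarkovOp μ A) (hf : Integrable f μ) (N : ℕ) :
    A (poissonSum A f N) =ᵐ[μ] fun x => ∑ k ∈ Finset.range N, A^[k + 1] f x := by
  filter_upwards [hA.sum (Finset.range N) (g := fun k => A^[k] f)
    fun k _ => (hA.iterate k).integrable hf] with x hx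
  rw [poissonSum, hx, Finset.sum_apply]
  refine Finset.sum_congr rfl fun k _ => ?_
  rw [Function.iterate_succ_apply']

lemma poissonSum_sub_apply (hA : IsMarkovOp μ A) (hf : Integrable f μ) (N : ℕ) :
    ∀ᵐ x ∂μ, f x = poissonSum A f N x - A (poissonSum A f N) x + A^[N] f x := by
  filter_upwards [apply_poissonSum hA hf N] with x hx
  have h := Finset.sum_range_succ' (fun k => A^[k] f x) N
  rw [Finset.sum_range_succ] at h
  rw [hx, poissonSum, Finset.sum_apply]
  simp only [Function.iterate_zero, id_eq] at h
  linarith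

lemma integral_sq_poissonSum_sub_le (hA : IsMarkovOp μ A) (hf : MemLp f 2 μ) {b : ℝ} (n : ℕ)
    (hb : ∀ k, |∫ x, A^[k] f x * A^[n + 1] f x ∂μ| ≤ b) :
    ∫ x, poissonSum A f (n + 1) x ^ 2 ∂μ - ∫ x, A (poissonSum A f (n + 1)) x ^ 2 ∂μ
      ≤ ∫ x, f x ^ 2 ∂μ + 2 * ∑ k ∈ Finset.range n, ∫ x, f x * A^[k + 1] f x ∂μ
        + 2 * ((n : ℝ) + 1) * b + 2 * b := by
  set g := poissonSum A f (n + 1) with hg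
  set u := A^[n + 1] f with hu
  have hL : ∀ k, MemLp (A^[k] f) 2 μ := fun k => (hA.iterate k).memLp_two hf
  have hgL : MemLp g 2 μ := memLp_two_poissonSum hA hf _
  have huL : MemLp u 2 μ := hL _
  have hAgL := hA.memLp_two hgL
  have igf : Integrable (fun x => g x * f x) μ := hgL.integrable_mul hf
  have igu : Integrable (fun x => g x * u x) μ := hgL.integrable_mul huL
  have ifu : Integrable (fun x => f x * u x) μ := hf.integrable_mul huL
  have e1 : ∫ x, g x ^ 2 ∂μ - ∫ x, A g x ^ 2 ∂μ
      = 2 * ∫ x, g x * f x ∂μ - 2 * ∫ x, g x * u x ∂μ - ∫ x, f x ^ 2 ∂μ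
        + 2 * ∫ x, f x * u x ∂μ - ∫ x, u x ^ 2 ∂μ := by
    rw [← integral_sub hgL.integrable_sq hAgL.integrable_sq]
    simp_rw [← integral_const_mul]
    have j1 : Integrable (fun x => 2 * (g x * f x) - 2 * (g x * u x)) μ :=
      (igf.const_mul 2).sub (igu.const_mul 2)
    have j2 : Integrable (fun x => 2 * (g x * f x) - 2 * (g x * u x) - f x ^ 2) μ :=
      j1.sub hf.integrable_sq
    have j3 : Integrable (fun x => 2 * (g x * f x) - 2 * (g x * u x) - f x ^ 2
        + 2 * (f x * u x)) μ := j2.add (ifu.const_mul 2)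
    rw [← integral_sub (igf.const_mul 2) (igu.const_mul 2), ← integral_sub j1 hf.integrable_sq,
      ← integral_add j2 (ifu.const_mul 2), ← integral_sub j3 huL.integrable_sq]
    refine integral_congr_ae ?_
    filter_upwards [poissonSum_sub_apply hA (hf.integrable one_le_two) (n + 1)] with x hx
    have : A g x = g x - f x + u x := by
      rw [hg, hu]
      linarith
    rw [this]
    ring
  have esum : ∀ h : α → ℝ, MemLp h 2 μ → ∫ x, g x * h x ∂μ
      = ∑ k ∈ Finset.range (n + 1), ∫ x, A^[k] f x * h x ∂μ := fun h hh => by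
    have hi : ∀ k ∈ Finset.range (n + 1), Integrable (fun x => A^[k] f x * h x) μ :=
      fun k _ => (hL k).integrable_mul hh
    rw [← integral_finsetSum _ hi]
    refine integral_congr_ae (ae_of_all _ fun x => ?_)
    simp [hg, poissonSum, Finset.sum_apply, Finset.sum_mul]
  have e2 : ∫ x, g x * f x ∂μ
      = ∫ x, f x ^ 2 ∂μ + ∑ k ∈ Finset.range n, ∫ x, f x * A^[k + 1] f x ∂μ := by
    rw [esum f hf, Finset.sum_range_succ', add_comm]
    simp only [Function.iterate_zero, id_eq, ← sq, mul_comm]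
  have e3 : -∫ x, g x * u x ∂μ ≤ ((n : ℝ) + 1) * b := by
    rw [esum u huL, ← Finset.sum_neg_distrib]
    refine (Finset.sum_le_sum fun k _ => (neg_le_abs _).trans (hb k)).trans ?_
    simp
  have e4 : ∫ x, f x * u x ∂μ ≤ b := (le_abs_self _).trans (hb 0)
  have e5 : 0 ≤ ∫ x, u x ^ 2 ∂μ := integral_nonneg fun x => sq_nonneg _
  linarith

/-- Approximate solutions of Poisson's equation with arbitrarily small martingale variance,
when the asymptotic variance vanishes. -/
lemma exists_approx_poisson (hA : IsMarkovOp μ A) (hf : MemLp f 2 μ) {b : ℕ → ℝ}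
    (hb : Summable fun k => b (k + 1)) (hdev : ∀ N, meanDev μ A^[N] f ≤ b N)
    (hcov : ∀ N k, |∫ x, A^[k] f x * (A^[N] f x - ∫ y, f y ∂μ) ∂μ| ≤ b N)
    (hvar : (∫ x, (f x - ∫ y, f y ∂μ) ^ 2 ∂μ) +
        2 * ∑' k : ℕ, ∫ x, (f x - ∫ y, f y ∂μ) * A^[k + 1] f x ∂μ = 0) :
    ∃ D : ℝ, 0 ≤ D ∧ ∀ ε : ℝ, 0 < ε → ∃ g u : α → ℝ, MemLp g 2 μ ∧ Integrable u μ ∧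
      (∀ᵐ x ∂μ, f x - ∫ y, f y ∂μ = g x - A g x + u x) ∧
      ∫ x, |u x| ∂μ ≤ ε ∧ ∫ x, g x ^ 2 ∂μ - ∫ x, A g x ^ 2 ∂μ ≤ ε ∧ ∫ x, |A g x| ∂μ ≤ D := by
  set m := ∫ y, f y ∂μ with hm
  have hf1 := hf.integrable one_le_two
  set f₀ : α → ℝ := fun x => f x - m with hf₀
  have hf₀L : MemLp f₀ 2 μ := hf.sub (memLp_const m)
  have hf₀1 := hf₀L.integrable one_le_two
  have hint₀ : ∫ x, f₀ x ∂μ = 0 := by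
    rw [hf₀, integral_sub hf1 (integrable_const m)]
    simp [hm]
  have hu : ∀ k, A^[k] f₀ =ᵐ[μ] fun x => A^[k] f x - m := fun k =>
    (hA.iterate k).apply_sub_const hf1 m
  have huint : ∀ k, ∫ x, |A^[k] f₀ x| ∂μ ≤ b k := fun k => by
    refine le_trans (le_of_eq (integral_congr_ae ?_)) (hdev k)
    filter_upwards [hu k] with x hx
    rw [hx]
  have hb0 : ∀ k, 0 ≤ b k := fun k => (integral_nonneg fun x => abs_nonneg _).trans (huint k)
  have hcov₀ : ∀ N k, |∫ x, A^[k] f₀ x * A^[N] f₀ x ∂μ| ≤ b N := fun N k => by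
    have hN : MemLp (A^[N] f₀) 2 μ := (hA.iterate N).memLp_two hf₀L
    have hz : ∫ x, A^[N] f₀ x ∂μ = 0 := ((hA.iterate N).integral hf₀1).trans hint₀
    refine le_trans (le_of_eq (congrArg _ ?_)) (hcov N k)
    have hi : Integrable (fun x => A^[k] f x * A^[N] f₀ x) μ :=
      ((hA.iterate k).memLp_two hf).integrable_mul hN
    calc ∫ x, A^[k] f₀ x * A^[N] f₀ x ∂μ
        = ∫ x, (A^[k] f x * A^[N] f₀ x - m * A^[N] f₀ x) ∂μ := by
          refine integral_congr_ae ?_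
          filter_upwards [hu k] with x hx
          rw [hx]
          ring
      _ = ∫ x, A^[k] f x * A^[N] f₀ x ∂μ := by
          rw [integral_sub hi ((hN.integrable one_le_two).const_mul m), integral_const_mul, hz]
          ring
      _ = _ := by
          refine integral_congr_ae ?_
          filter_upwards [hu N] with x hx
          rw [hx]
  have hγ : ∀ k, ∫ x, (f x - m) * A^[k + 1] f x ∂μ = ∫ x, f₀ x * A^[k + 1] f₀ x ∂μ := fun k => by
    have hi : Integrable (fun x => f₀ x * A^[k + 1] f x) μ :=
      hf₀L.integrable_mul ((hA.iterate (k + 1)).memLp_two hf)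
    calc ∫ x, (f x - m) * A^[k + 1] f x ∂μ = ∫ x, (f₀ x * A^[k + 1] f x - f₀ x * m) ∂μ := by
          rw [integral_sub hi (hf₀1.mul_const m), integral_mul_const, hint₀,
            zero_mul, sub_zero]
      _ = _ := by
          refine integral_congr_ae ?_
          filter_upwards [hu (k + 1)] with x hx
          rw [hx]
          ring
  simp_rw [hγ] at hvar
  have hγsum : Summable fun k => ∫ x, f₀ x * A^[k + 1] f₀ x ∂μ :=
    Summable.of_norm_bounded hb fun k => hcov₀ (k + 1) 0
  have hlim : Tendsto (fun n => ∫ x, f₀ x ^ 2 ∂μ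
      + 2 * ∑ k ∈ Finset.range n, ∫ x, f₀ x * A^[k + 1] f₀ x ∂μ) atTop (𝓝 0) := by
    rw [← hvar]
    exact (hγsum.hasSum.tendsto_sum_nat.const_mul 2).const_add _
  refine ⟨∑' k, b (k + 1), tsum_nonneg fun k => hb0 _, fun ε hε => ?_⟩
  obtain ⟨n, ⟨hn1, hn2⟩, hn3⟩ := exists_lt_and_mul_lt_of_summable hb (ε := ε / 8) (by positivity)
    ((hlim.eventually (gt_mem_nhds (by positivity : 0 < ε / 4))).and
      (hb.tendsto_atTop_zero.eventually (gt_mem_nhds (by positivity : 0 < ε / 8))))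
  refine ⟨poissonSum A f₀ (n + 1), A^[n + 1] f₀, memLp_two_poissonSum hA hf₀L _,
    (hA.iterate _).integrable hf₀1, poissonSum_sub_apply hA hf₀1 _, ?_, ?_, ?_⟩
  · linarith [huint (n + 1)]
  · refine (integral_sq_poissonSum_sub_le hA hf₀L n (hcov₀ (n + 1))).trans ?_
    linarith
  · calc ∫ x, |A (poissonSum A f₀ (n + 1)) x| ∂μ
        ≤ ∫ x, ∑ k ∈ Finset.range (n + 1), |A^[k + 1] f₀ x| ∂μ := by
          refine integral_mono_ae
            (hA.integrable ((memLp_two_poissonSum hA hf₀L _).integrable one_le_two)).abs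
            (integrable_finsetSum _ fun k _ => ((hA.iterate _).integrable hf₀1).abs) ?_
          filter_upwards [apply_poissonSum hA hf₀1 (n + 1)] with x hx
          rw [hx]
          exact Finset.abs_sum_le_sum_abs _ _
      _ = ∑ k ∈ Finset.range (n + 1), ∫ x, |A^[k + 1] f₀ x| ∂μ :=
          integral_finsetSum _ fun k _ => ((hA.iterate _).integrable hf₀1).abs
      _ ≤ ∑ k ∈ Finset.range (n + 1), b (k + 1) := Finset.sum_le_sum fun k _ => huint _
      _ ≤ _ := hb.sum_le_tsum _ fun k _ => hb0 _

end Corrector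

section Modulus

variable {c : ℝ → ℝ} {x δ : ℝ}

lemma ConcaveOn.monotoneOn_of_nonneg (hc : ConcaveOn ℝ (Ici (0 : ℝ)) c)
    (hpos : ∀ x, 0 ≤ x → 0 ≤ c x) : MonotoneOn c (Ici 0) := by
  intro x hx y hy hxy
  rw [mem_Ici] at hx hy
  by_contra! hlt
  have hxy' : x < y := lt_of_le_of_ne hxy (by rintro rfl; exact lt_irrefl _ hlt)
  set s := (c x - c y) / (y - x) with hs
  have hs0 : 0 < s := div_pos (by linarith) (by linarith)
  have hcy := hpos y hy
  set z := y + (c y + 1) / s with hz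
  have hyz : y < z := by
    have : 0 < (c y + 1) / s := by positivity
    linarith
  have h := hc.slope_anti_adjacent (mem_Ici.2 hx) (mem_Ici.2 (hy.trans hyz.le)) hxy' hyz
  have e : (c y - c x) / (y - x) = -s := by rw [hs]; ring
  have e' : z - y = (c y + 1) / s := by rw [hz]; ring
  rw [e, e', div_le_iff₀ (by positivity)] at h
  have e2 : -s * ((c y + 1) / s) = -(c y + 1) := by field_simp
  rw [e2] at h
  linarith [hpos z (hy.trans hyz.le)]

lemma ConcaveOn.le_mul_one_add_div (hc : ConcaveOn ℝ (Ici (0 : ℝ)) c)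
    (hpos : ∀ x, 0 ≤ x → 0 ≤ c x) (hδ : 0 < δ) (hx : 0 ≤ x) :
    c x ≤ c δ * (1 + x / δ) := by
  have hcδ := hpos δ hδ.le
  have hxδ : 0 ≤ x / δ := by positivity
  rcases le_total x δ with h | h
  · have h1 := hc.monotoneOn_of_nonneg hpos (mem_Ici.2 hx) (mem_Ici.2 hδ.le) h
    nlinarith
  · have hx0 : 0 < x := hδ.trans_le h
    have ha : 0 ≤ 1 - δ / x := sub_nonneg.2 ((div_le_one hx0).2 h)
    have hb : 0 ≤ δ / x := by positivity
    have h1 := hc.2 (mem_Ici.2 (le_refl (0 : ℝ))) (mem_Ici.2 hx) ha hb (by ring)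
    simp only [smul_eq_mul, mul_zero, zero_add] at h1
    rw [div_mul_cancel₀ _ hx0.ne'] at h1
    have h2 : 0 ≤ (1 - δ / x) * c 0 :=
      mul_nonneg ha (hpos 0 le_rfl)
    have h3 : δ / x * c x ≤ c δ := by linarith
    have h4 : c x ≤ c δ * (x / δ) := by
      calc c x = (δ / x * c x) * (x / δ) := by field_simp
        _ ≤ c δ * (x / δ) := by gcongr
    linarith

lemma zero_mem_LipC (hpos : ∀ x, 0 ≤ x → 0 ≤ c x) : (fun _ => 0) ∈ LipC c := fun x y => by
  simpa using hpos _ (abs_nonneg (x - y))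

lemma dC_dirac_zero_le {Q : Measure ℝ} [IsProbabilityMeasure Q] {E : ℝ}
    (hc : ConcaveOn ℝ (Ici (0 : ℝ)) c) (hpos : ∀ x, 0 ≤ x → 0 ≤ c x) (hδ : 0 < δ)
    (hQ : Integrable (fun x => x) Q) (hE : 0 ≤ E) (hQE : ∫ x, |x| ∂Q ≤ δ * E) :
    dC c Q (Measure.dirac 0) ≤ (1 + E) * c δ := by
  have hcδ := hpos δ hδ.le
  unfold dC
  by_cases hbdd : BddAbove (range fun g : LipC c =>
      |(∫ x, (g : ℝ → ℝ) x ∂Q) - ∫ x, (g : ℝ → ℝ) x ∂(Measure.dirac (0 : ℝ))|)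
  · have : Nonempty (LipC c) := ⟨⟨_, zero_mem_LipC hpos⟩⟩
    refine ciSup_le fun g => ?_
    obtain ⟨g, hg⟩ := g
    have hgQ : Integrable g Q := by
      by_contra hni
      obtain ⟨B, hB⟩ := hbdd
      have hg' : (fun x => g x + (B + 1 - g 0)) ∈ LipC c := fun x y => by
        simpa using hg x y
      have h := hB ⟨⟨_, hg'⟩, rfl⟩
      simp only [integral_dirac] at h
      rw [integral_undef] at h
      · have := neg_le_abs (0 - (g 0 + (B + 1 - g 0)))
        linarith
      · intro hi
        refine hni ?_
        refine (hi.sub (integrable_const (B + 1 - g 0))).congr (ae_of_all _ fun x => ?_)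
        simp
    simp only [integral_dirac]
    have hgc : ∀ x, |g x - g 0| ≤ c δ * (1 + |x| / δ) := fun x => by
      refine (hg x 0).trans ?_
      rw [sub_zero]
      exact hc.le_mul_one_add_div hpos hδ (abs_nonneg x)
    have hi2 : Integrable (fun x => c δ * (1 + |x| / δ)) Q :=
      ((integrable_const 1).add (hQ.abs.div_const δ)).const_mul _
    calc |∫ x, g x ∂Q - g 0| = |∫ x, (g x - g 0) ∂Q| := by
          rw [integral_sub hgQ (integrable_const _)]
          simp
      _ ≤ ∫ x, |g x - g 0| ∂Q := abs_integral_le_integral_abs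
      _ ≤ ∫ x, c δ * (1 + |x| / δ) ∂Q :=
          integral_mono (hgQ.sub (integrable_const _)).abs hi2 hgc
      _ = c δ * (1 + (∫ x, |x| ∂Q) / δ) := by
          rw [integral_const_mul, integral_add (integrable_const 1) (hQ.abs.div_const δ),
            integral_div]
          simp
      _ ≤ c δ * (1 + E) := by
          gcongr
          rw [div_le_iff₀ hδ]
          linarith
      _ = _ := mul_comm _ _
  · rw [Real.iSup_of_not_bddAbove hbdd]
    positivity

end Modulus

section Chain

variable {Ω : Type*} [MeasurableSpace Ω] {P : Measure Ω} [IsProbabilityMeasure P]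
  {X : ℕ → Ω → ℝ} {μ : Measure ℝ} [IsProbabilityMeasure μ] {K : Kernel ℝ ℝ} [IsMarkovKernel K]

lemma MeasureTheory.MeasurePreserving.integral_comp_of_aestronglyMeasurable {β : Type*}
    [MeasurableSpace β] {ν : Measure β} {T : Ω → β} (hT : MeasurePreserving T P ν) {F : β → ℝ}
    (hF : AEStronglyMeasurable F ν) : ∫ ω, F (T ω) ∂P = ∫ y, F y ∂ν := by
  rw [← hT.map_eq] at hF
  have h := integral_map hT.measurable.aemeasurable hF
  rw [hT.map_eq] at h
  exact h.symm

lemma measurePreserving_of_stationary (hXm : ∀ i, Measurable (X i))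
    (hX0 : Measure.map (X 0) P = μ)
    (hstat : ∀ k n : ℕ,
      Measure.map (fun ω => fun i : Fin n => X (i.1 + k) ω) P
        = Measure.map (fun ω => fun i : Fin n => X i.1 ω) P) (i : ℕ) :
    MeasurePreserving (X i) P μ := by
  refine ⟨hXm i, ?_⟩
  have h := congrArg (Measure.map fun v : Fin 1 → ℝ => v 0) (hstat i 1)
  rw [Measure.map_map (measurable_pi_apply _) (measurable_pi_lambda _ fun j => hXm _),
    Measure.map_map (measurable_pi_apply _) (measurable_pi_lambda _ fun j => hXm _)] at h
  have e1 : ((fun v : Fin 1 → ℝ => v 0) ∘ fun ω => fun j : Fin 1 => X (j.1 + i) ω) = X i := by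
    ext ω
    simp
  have e2 : ((fun v : Fin 1 → ℝ => v 0) ∘ fun ω => fun j : Fin 1 => X j.1 ω) = X 0 := by
    ext ω
    simp
  rw [e1, e2, hX0] at h
  exact h

lemma measurePreserving_pair (hXm : ∀ i, Measurable (X i)) {n : ℕ}
    (hn : MeasurePreserving (X n) P μ)
    (hMarkov : ∀ g : ℝ → ℝ, Measurable g → (∃ C, ∀ x, |g x| ≤ C) →
      P[fun ω => g (X (n + 1) ω)
          | MeasurableSpace.comap (fun ω => fun i : Fin (n + 1) => X i.1 ω) inferInstance]
        =ᵐ[P] fun ω => Kop K g (X n ω)) :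
    MeasurePreserving (fun ω => (X n ω, X (n + 1) ω)) P (μ ⊗ₘ K) := by
  have hpair : Measurable fun ω => (X n ω, X (n + 1) ω) := (hXm n).prodMk (hXm (n + 1))
  have := Measure.isProbabilityMeasure_map (μ := P) hpair.aemeasurable
  refine ⟨hpair, Measure.ext_prod fun {s t} hs ht => ?_⟩
  rw [Measure.map_apply hpair (hs.prod ht), Measure.compProd_apply_prod hs ht]
  have hpast : Measurable fun ω => fun i : Fin (n + 1) => X i.1 ω :=
    measurable_pi_lambda _ fun i => hXm _
  have hle := hpast.comap_le
  have hsG : MeasurableSet[MeasurableSpace.comap (fun ω => fun i : Fin (n + 1) => X i.1 ω)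
      inferInstance] (X n ⁻¹' s) := by
    refine ⟨(fun v : Fin (n + 1) → ℝ => v (Fin.last n)) ⁻¹' s, measurable_pi_apply _ hs, ?_⟩
    rw [← preimage_comp]
    rfl
  set g : ℝ → ℝ := t.indicator fun _ => 1 with hg
  have hgm : Measurable g := measurable_const.indicator ht
  have hgb : ∀ x, |g x| ≤ 1 := fun x => by
    by_cases hx : x ∈ t <;> simp [hg, hx]
  have hgi : Integrable (fun ω => g (X (n + 1) ω)) P :=
    Integrable.of_bound (hgm.comp (hXm _)).aestronglyMeasurable 1 (ae_of_all _ fun ω => hgb _)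
  have hK : ∀ x, Kop K g x = (K x).real t := fun x => by
    simp [Kop, hg, integral_indicator ht]
  have hKm : Measurable fun x => (K x).real t := (K.measurable_coe ht).ennreal_toReal
  have h1 := setIntegral_condExp hle hgi hsG
  rw [setIntegral_congr_ae (hle _ hsG) ((hMarkov g hgm ⟨1, hgb⟩).mono fun ω h _ => h)] at h1
  simp_rw [hK] at h1
  have h2 : ∫ ω in X n ⁻¹' s, g (X (n + 1) ω) ∂P
      = P.real ((fun ω => (X n ω, X (n + 1) ω)) ⁻¹' (s ×ˢ t)) := by
    have e : (fun ω => g (X (n + 1) ω)) = (X (n + 1) ⁻¹' t).indicator fun _ => (1 : ℝ) := by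
      ext ω
      by_cases hx : X (n + 1) ω ∈ t <;> simp [hg, hx]
    rw [e, setIntegral_indicator (hXm _ ht)]
    simp [mk_preimage_prod]
  have h3 : ∫ ω in X n ⁻¹' s, (K (X n ω)).real t ∂P = ∫ x in s, (K x).real t ∂μ := by
    rw [← hn.map_eq, setIntegral_map hs hKm.aestronglyMeasurable (hXm n).aemeasurable]
  have h4 : ∫ x in s, (K x).real t ∂μ = (∫⁻ x in s, K x t ∂μ).toReal :=
    integral_toReal (K.measurable_coe ht).aemeasurable (ae_of_all _ fun x => measure_lt_top _ _)
  have h5 : ∫⁻ x in s, K x t ∂μ ≠ ∞ := by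
    rw [← Measure.compProd_apply_prod hs ht]
    exact measure_ne_top _ _
  rw [h2, h3, h4] at h1
  exact ((ENNReal.toReal_eq_toReal_iff' h5 (measure_ne_top _ _)).1 h1).symm

end Chain

section PartialSums

variable {Ω : Type*} [MeasurableSpace Ω] {P : Measure Ω} [IsProbabilityMeasure P]
  {X : ℕ → Ω → ℝ} {μ : Measure ℝ} [IsProbabilityMeasure μ] {K : Kernel ℝ ℝ} [IsMarkovKernel K]
  {f g u : ℝ → ℝ} {m η D : ℝ}

lemma integral_abs_sub_Kop_le (hinv : μ.bind (fun x => K x) = μ) (hg : MemLp g 2 μ) (hη : 0 ≤ η)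
    (hgη : ∫ x, g x ^ 2 ∂μ - ∫ x, Kop K g x ^ 2 ∂μ ≤ η ^ 2) :
    ∫ z, |g z.2 - Kop K g z.1| ∂(μ ⊗ₘ K) ≤ η := by
  obtain ⟨hL, hsq⟩ := integral_sq_sub_Kop hinv hg
  have h := sq_integral_le_integral_sq hL.abs
  simp only [Pi.abs_apply, sq_abs] at h
  rw [hsq] at h
  exact abs_le_of_sq_le_sq' (h.trans hgη) hη |>.2

lemma sum_range_eq_martingale_add_boundary {d v w : ℕ → ℝ} {n : ℕ} {a : ℕ → ℝ}
    (h : ∀ i < n, a (i + 1) = v (i + 1) - w (i + 1) + d (i + 1)) :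
    ∑ i ∈ Finset.range n, a (i + 1)
      = ∑ i ∈ Finset.range n, (v (i + 1) - w i) + (w 0 - w n)
        + ∑ i ∈ Finset.range n, d (i + 1) := by
  rw [← Finset.sum_range_sub' w n, ← Finset.sum_add_distrib, ← Finset.sum_add_distrib]
  refine Finset.sum_congr rfl fun i hi => ?_
  rw [h i (Finset.mem_range.1 hi)]
  ring

lemma integral_abs_sum_le (hinv : μ.bind (fun x => K x) = μ)
    (hX : ∀ i, MeasurePreserving (X i) P μ)
    (hpair : ∀ i, MeasurePreserving (fun ω => (X i ω, X (i + 1) ω)) P (μ ⊗ₘ K))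
    (hg : MemLp g 2 μ) (hu : Integrable u μ) (hη : 0 ≤ η)
    (hfg : ∀ᵐ x ∂μ, f x - m = g x - Kop K g x + u x)
    (huη : ∫ x, |u x| ∂μ ≤ η)
    (hgη : ∫ x, g x ^ 2 ∂μ - ∫ x, Kop K g x ^ 2 ∂μ ≤ η ^ 2)
    (hD : ∫ x, |Kop K g x| ∂μ ≤ D) (n : ℕ) :
    ∫ ω, |∑ i ∈ Finset.range n, (f (X (i + 1) ω) - m)| ∂P ≤ 2 * D + n * (2 * η) := by
  have hKg := integrable_Kop hinv (hg.integrable one_le_two)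
  have hd := (integral_sq_sub_Kop hinv hg).1.integrable one_le_two
  have id (i : ℕ) : Integrable (fun ω => |g (X (i + 1) ω) - Kop K g (X i ω)|) P :=
    ((hpair i).integrable_comp_of_integrable hd).abs
  have iw (i : ℕ) : Integrable (fun ω => |Kop K g (X i ω)|) P :=
    ((hX i).integrable_comp_of_integrable hKg).abs
  have iu (i : ℕ) : Integrable (fun ω => |u (X (i + 1) ω)|) P :=
    ((hX (i + 1)).integrable_comp_of_integrable hu).abs
  have ed (i : ℕ) : ∫ ω, |g (X (i + 1) ω) - Kop K g (X i ω)| ∂P ≤ η := by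
    have e := (hpair i).integral_comp_of_aestronglyMeasurable hd.abs.aestronglyMeasurable
    exact e.le.trans (integral_abs_sub_Kop_le hinv hg hη hgη)
  have ew (i : ℕ) : ∫ ω, |Kop K g (X i ω)| ∂P ≤ D :=
    ((hX i).integral_comp_of_aestronglyMeasurable hKg.abs.aestronglyMeasurable).le.trans hD
  have eu (i : ℕ) : ∫ ω, |u (X (i + 1) ω)| ∂P ≤ η :=
    ((hX (i + 1)).integral_comp_of_aestronglyMeasurable hu.abs.aestronglyMeasurable).le.trans huη
  have hae : ∀ᵐ ω ∂P, ∀ i : ℕ, f (X (i + 1) ω) - m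
      = g (X (i + 1) ω) - Kop K g (X (i + 1) ω) + u (X (i + 1) ω) :=
    ae_all_iff.2 fun i => (hX (i + 1)).quasiMeasurePreserving.ae hfg
  have i1 : Integrable (fun ω => ∑ i ∈ Finset.range n, |g (X (i + 1) ω) - Kop K g (X i ω)|) P :=
    integrable_finsetSum _ fun i _ => id i
  have i2 : Integrable (fun ω => |Kop K g (X 0 ω)| + |Kop K g (X n ω)|) P := (iw 0).add (iw n)
  have i3 : Integrable (fun ω => ∑ i ∈ Finset.range n, |u (X (i + 1) ω)|) P :=
    integrable_finsetSum _ fun i _ => iu i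
  have i12 : Integrable (fun ω => ∑ i ∈ Finset.range n, |g (X (i + 1) ω) - Kop K g (X i ω)|
      + (|Kop K g (X 0 ω)| + |Kop K g (X n ω)|)) P := i1.add i2
  calc ∫ ω, |∑ i ∈ Finset.range n, (f (X (i + 1) ω) - m)| ∂P
      ≤ ∫ ω, (∑ i ∈ Finset.range n, |g (X (i + 1) ω) - Kop K g (X i ω)|
        + (|Kop K g (X 0 ω)| + |Kop K g (X n ω)|)
        + ∑ i ∈ Finset.range n, |u (X (i + 1) ω)|) ∂P := by
        refine integral_mono_of_nonneg (ae_of_all _ fun ω => abs_nonneg _) (i12.add i3) ?_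
        filter_upwards [hae] with ω hω
        rw [sum_range_eq_martingale_add_boundary (a := fun i => f (X i ω) - m)
          (v := fun i => g (X i ω)) (w := fun i => Kop K g (X i ω))
          (d := fun i => u (X i ω)) fun i _ => hω i]
        refine (abs_add_three _ _ _).trans ?_
        gcongr
        · exact Finset.abs_sum_le_sum_abs _ _
        · exact abs_sub _ _
        · exact Finset.abs_sum_le_sum_abs _ _
    _ = ∑ i ∈ Finset.range n, ∫ ω, |g (X (i + 1) ω) - Kop K g (X i ω)| ∂P
        + (∫ ω, |Kop K g (X 0 ω)| ∂P + ∫ ω, |Kop K g (X n ω)| ∂P)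
        + ∑ i ∈ Finset.range n, ∫ ω, |u (X (i + 1) ω)| ∂P := by
        rw [integral_add i12 i3, integral_add i1 i2, integral_add (iw 0) (iw n),
          integral_finsetSum _ fun i _ => id i, integral_finsetSum _ fun i _ => iu i]
    _ ≤ ∑ i ∈ Finset.range n, η + (D + D) + ∑ i ∈ Finset.range n, η := by
        gcongr
        · exact ed _
        · exact ew 0
        · exact ew n
        · exact eu _
    _ = _ := by
        simp only [Finset.sum_const, Finset.card_range, nsmul_eq_mul]
        ring

lemma exists_bound_integral_abs_sum (hinv : μ.bind (fun x => K x) = μ)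
    (hX : ∀ i, MeasurePreserving (X i) P μ)
    (hpair : ∀ i, MeasurePreserving (fun ω => (X i ω, X (i + 1) ω)) P (μ ⊗ₘ K))
    {M : ℝ} (hM : 0 < M) {p : ℝ≥0∞} (hp : 2 < p) (hf : ClassC M p μ f)
    (hsum : Summable fun k : ℕ =>
      (alpha1 (Kop K) μ (k + 1)) ^ (((1 : ℝ≥0∞) - 2 / p).toReal))
    (hvar : (∫ x, (f x - ∫ y, f y ∂μ) ^ 2 ∂μ) +
        2 * ∑' k : ℕ, ∫ x, (f x - ∫ y, f y ∂μ) * (Kop K)^[k + 1] f x ∂μ = 0) :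
    ∃ E : ℝ, 0 ≤ E ∧ ∀ n : ℕ,
      ∫ ω, |∑ i ∈ Finset.range n, (f (X (i + 1) ω) - ∫ y, f y ∂μ)| ∂P ≤ E := by
  have hA := isMarkovOp_Kop hinv
  obtain ⟨C, -, hdecay⟩ := hf.exists_decay_const hA hM hp
  obtain ⟨D, hD, happrox⟩ := exists_approx_poisson hA (hf.memLp_two hM hp)
    (b := fun N => C * alpha1 (Kop K) μ N ^ (((1 : ℝ≥0∞) - 2 / p).toReal)) (hsum.mul_left C)
    (fun N => (hdecay N).1) (fun N k => (hdecay N).2 k) hvar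
  refine ⟨2 * D + 2, by positivity, fun n => ?_⟩
  set η : ℝ := 1 / (n + 1) with hη
  have hη0 : 0 < η := by positivity
  have hη1 : η ≤ 1 := (div_le_one (by positivity)).2 (by linarith [n.cast_nonneg (α := ℝ)])
  have hnη : n * η ≤ 1 := by
    rw [hη, mul_one_div, div_le_one (by positivity)]
    linarith
  obtain ⟨g, u, hg, hu, hfg, huη, hgη, hKg⟩ := happrox (η ^ 2) (by positivity)
  have h := integral_abs_sum_le hinv hX hpair hg hu hη0.le hfg
    (huη.trans (pow_le_of_le_one hη0.le hη1 two_ne_zero)) hgη hKg n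
  linarith

end PartialSums

/-- Theorem 4(1): for a stationary Markov chain, if
`f ∈ C(M,p,μ)` with `p ∈ (2,∞]`, `Σ_{k>0} α_1(k)^{(p−2)/p} < ∞` and
`σ²(μ,K,f) = 0`, then for every concave `c` with `c(0)=0`,
`d_c(P_n(f), δ_0) = O(c(n^{-1/2}))`. -/
theorem statement12 {Ω : Type*} [MeasurableSpace Ω] (P : Measure Ω)
    [IsProbabilityMeasure P] (X : ℕ → Ω → ℝ) (hXm : ∀ i, Measurable (X i))
    (μ : Measure ℝ) [IsProbabilityMeasure μ]
    (K : Kernel ℝ ℝ) [IsMarkovKernel K] (hinv : μ.bind (fun x => K x) = μ)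
    (hX0 : Measure.map (X 0) P = μ)
    (hMarkov : ∀ n : ℕ, ∀ g : ℝ → ℝ, Measurable g → (∃ C, ∀ x, |g x| ≤ C) →
      P[fun ω => g (X (n + 1) ω)
          | MeasurableSpace.comap (fun ω => fun i : Fin (n + 1) => X i.1 ω) inferInstance]
        =ᵐ[P] fun ω => Kop K g (X n ω))
    (hstat : ∀ k n : ℕ,
      Measure.map (fun ω => fun i : Fin n => X (i.1 + k) ω) P
        = Measure.map (fun ω => fun i : Fin n => X i.1 ω) P)
    (M : ℝ) (hM : 0 < M) (p : ℝ≥0∞) (hp : 2 < p)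
    (f : ℝ → ℝ) (hf : ClassC M p μ f)
    (hsum : Summable fun k : ℕ =>
      (alpha1 (Kop K) μ (k + 1)) ^ (((1:ℝ≥0∞) - 2 / p).toReal))
    (hvar : (∫ x, (f x - ∫ y, f y ∂μ) ^ 2 ∂μ) +
        2 * ∑' k : ℕ, ∫ x, (f x - ∫ y, f y ∂μ) * (Kop K)^[k + 1] f x ∂μ = 0) :
    ∀ c : ℝ → ℝ, ConcaveOn ℝ (Set.Ici (0:ℝ)) c → c 0 = 0 →
      (∀ x : ℝ, 0 ≤ x → 0 ≤ c x) →
      ∃ B : ℝ, ∀ n : ℕ, 1 ≤ n →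
        dC c (Measure.map (fun ω => (n : ℝ) ^ (-(1:ℝ)/2) *
            ∑ i ∈ Finset.range n, (f (X (i + 1) ω) - ∫ y, f y ∂μ)) P)
          (Measure.dirac 0)
          ≤ B * c ((n : ℝ) ^ (-(1:ℝ)/2)) := by
  have hX := measurePreserving_of_stationary hXm hX0 hstat
  have hpair (i : ℕ) := measurePreserving_pair hXm (hX i) (hMarkov i)
  obtain ⟨E, hE, hbound⟩ := exists_bound_integral_abs_sum hinv hX hpair hM hp hf hsum hvar
  intro c hc _ hpos
  refine ⟨1 + E, fun n hn => ?_⟩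
  have hδ : (0 : ℝ) < (n : ℝ) ^ (-(1 : ℝ) / 2) := Real.rpow_pos_of_pos (by exact_mod_cast hn) _
  set δ := (n : ℝ) ^ (-(1 : ℝ) / 2)
  have hS : Integrable (fun ω => δ * ∑ i ∈ Finset.range n, (f (X (i + 1) ω) - ∫ y, f y ∂μ)) P :=
    (integrable_finsetSum _ fun i _ =>
      ((hX (i + 1)).integrable_comp_of_integrable hf.1).sub (integrable_const _)).const_mul δ
  have hSm := hS.aestronglyMeasurable.aemeasurable
  have := Measure.isProbabilityMeasure_map hSm
  refine dC_dirac_zero_le hc hpos hδ ?_ hE ?_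
  · exact (integrable_map_measure aestronglyMeasurable_id hSm).2 hS
  · rw [integral_map hSm continuous_abs.aestronglyMeasurable]
    simp_rw [abs_mul, abs_of_pos hδ, integral_const_mul]
    exact mul_le_mul_of_nonneg_left (hbound n) hδ.le

end
end
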